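/- Let p be a prime and F a field of characteristic p. Let C be a cyclic F-algebra with exp C = p and deg C = p^2. Then λ_p(C) ≤ p. -/

import Mathlib

open scoped TensorProduct

/-- A finite-dimensional central simple algebra over a field `F`. -/
def IsCSA (F A : Type) [Field F] [Ring A] [Algebra F A] : Prop :=
  Algebra.IsCentral F A ∧ IsSimpleRing A ∧ FiniteDimensional F A

/-- An `F`-algebra is split if it is isomorphic to a matrix algebra over `F`. -/
def IsSplitAlg (F A : Type) [Field F] [Ring A] [Algebra F A] : Prop :=
  ∃ n : ℕ, 0 < n ∧ Nonempty (A ≃ₐ[F] Matrix (Fin n) (Fin n) F)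

/-- Brauer equivalence of two algebras over a field `F`. -/
def IsBrauerEquiv (F A B : Type) [Field F] [Ring A] [Algebra F A] [Ring B] [Algebra F B] :
    Prop :=
  ∃ n m : ℕ, 0 < n ∧ 0 < m ∧
    Nonempty ((Matrix (Fin n) (Fin n) A) ≃ₐ[F] (Matrix (Fin m) (Fin m) B))

/-- `A` has exponent `e`: `e` is the least positive integer such that the `e`-fold tensor
power of `A` over `F` is split. -/
def HasExponent (F A : Type) [Field F] [Ring A] [Algebra F A] (e : ℕ) : Prop :=
  0 < e ∧ IsSplitAlg F (⨂[F] _ : Fin e, A) ∧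
    ∀ k : ℕ, 0 < k → IsSplitAlg F (⨂[F] _ : Fin k, A) → e ≤ k

/-- `A` has (Schur) index `d`: `A` is isomorphic to a matrix algebra over a division
algebra of dimension `d ^ 2` over `F`. -/
def HasIndex (F A : Type) [Field F] [Ring A] [Algebra F A] (d : ℕ) : Prop :=
  ∃ (D : Type) (_ : DivisionRing D) (_ : Algebra F D) (m : ℕ), 0 < m ∧
    Nonempty (A ≃ₐ[F] Matrix (Fin m) (Fin m) D) ∧ Module.finrank F D = d ^ 2

/-- The (Schur) index of `A` is at most `d`. -/
def IndexLE (F A : Type) [Field F] [Ring A] [Algebra F A] (d : ℕ) : Prop :=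
  ∃ e : ℕ, e ≤ d ∧ HasIndex F A e

/-- `A` is the cyclic (symbol) algebra `[a, b)_{p,F}` of degree `p` in characteristic `p`:
it has dimension `p ^ 2` over `F` and is generated by elements `i`, `j` subject to
`i ^ p - i = a`, `j ^ p = b`, `j * i = (i - 1) * j`. -/
def IsCyclicAlgWith (p : ℕ) (F A : Type) [Field F] [Ring A] [Algebra F A] (a b : F) : Prop :=
  b ≠ 0 ∧ Module.finrank F A = p ^ 2 ∧
    ∃ i j : A, i ^ p - i = algebraMap F A a ∧ j ^ p = algebraMap F A b ∧
      j * i = (i - 1) * j ∧ Algebra.adjoin F {i, j} = ⊤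

/-- `A` is a cyclic algebra of degree `p`, i.e. of the form `[a, b)_{p,F}`. -/
def IsCyclicPAlg (p : ℕ) (F A : Type) [Field F] [Ring A] [Algebra F A] : Prop :=
  ∃ a b : F, IsCyclicAlgWith p F A a b

/-- The `p`-symbol length of `A` is at most `m`: `A` is Brauer equivalent to a tensor
product of at most `m` cyclic `F`-algebras of degree `p`. -/
def SymbolLengthLE (p : ℕ) (F A : Type) [Field F] [Ring A] [Algebra F A] (m : ℕ) : Prop :=
  ∃ k : ℕ, k ≤ m ∧ ∃ (D : Fin k → Type) (_ : ∀ i, Ring (D i)) (_ : ∀ i, Algebra F (D i)),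
    (∀ i, IsCyclicPAlg p F (D i)) ∧ IsBrauerEquiv F A (⨂[F] i, D i)

/-- `M` is a compositum `LK` of `L` and `K` over `F`: it is generated as an `F`-algebra by
the images of `L` and `K`. -/
def IsCompositum (F L K M : Type) [Field F] [Field L] [Field K] [Field M]
    [Algebra F L] [Algebra F K] [Algebra F M] [Algebra L M] [Algebra K M]
    [IsScalarTower F L M] [IsScalarTower F K M] : Prop :=
  (IsScalarTower.toAlgHom F L M).range ⊔ (IsScalarTower.toAlgHom F K M).range = ⊤

/-- A cyclic algebra of degree `m` over `F`: a central simple `F`-algebra of degree `m`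
containing a cyclic field extension of `F` of degree `m` (as a maximal subfield). -/
def IsCyclicAlgebra (F A : Type) [Field F] [Ring A] [Algebra F A] (m : ℕ) : Prop :=
  IsCSA F A ∧ Module.finrank F A = m ^ 2 ∧
  ∃ (L : Type) (_ : Field L) (_ : Algebra F L), IsGalois F L ∧ IsCyclic (L ≃ₐ[F] L) ∧
    Module.finrank F L = m ∧ Nonempty (L →ₐ[F] A)

/-- `L/F` is a `p`-extension: there is a tower of intermediate fields from `F` to `L`
each step of which is a cyclic extension of degree `p`. -/
def IsPExtension (p : ℕ) (F L : Type) [Field F] [Field L] [Algebra F L] : Prop :=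
  ∃ (n : ℕ) (T : Fin (n + 1) → IntermediateField F L),
    T 0 = ⊥ ∧ T (Fin.last n) = ⊤ ∧
    ∀ i : Fin n, ∃ h : T i.castSucc ≤ T i.succ,
      IsGalois (T i.castSucc) (IntermediateField.extendScalars h) ∧
      IsCyclic ((IntermediateField.extendScalars h) ≃ₐ[T i.castSucc]
        (IntermediateField.extendScalars h)) ∧
      Module.finrank (T i.castSucc) (IntermediateField.extendScalars h) = p

/-- `F` is `p`-cyclic reducible: for every central simple `F`-algebra `A` of exponent `p`
and every purely inseparable extension `K/F` with `K ^ p ⊆ F`, either `A_K` is split, or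
there is a separable extension `L/F` of degree `ind (A_K) / p` such that `A_{LK}` is
Brauer equivalent to a cyclic `LK`-algebra of degree `p`. -/
def IsPCyclicReducible (p : ℕ) (F : Type) [Field F] : Prop :=
  ∀ (A : Type) [Ring A] [Algebra F A], IsCSA F A → HasExponent F A p →
  ∀ (K : Type) [Field K] [Algebra F K], IsPurelyInseparable F K →
    (∀ z : K, z ^ p ∈ (algebraMap F K).range) →
    IsSplitAlg K (K ⊗[F] A) ∨
    ∃ d : ℕ, HasIndex K (K ⊗[F] A) (p * d) ∧
      ∃ (L : Type) (_ : Field L) (_ : Algebra F L), Algebra.IsSeparable F L ∧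
        Module.finrank F L = d ∧
        ∃ (M : Type) (_ : Field M) (_ : Algebra F M) (_ : Algebra L M) (_ : Algebra K M)
          (_ : IsScalarTower F L M) (_ : IsScalarTower F K M),
          IsCompositum F L K M ∧
          ∃ (C : Type) (_ : Ring C) (_ : Algebra M C),
            IsCyclicPAlg p M C ∧ IsBrauerEquiv M (M ⊗[F] A) C

/-- `F` is `p`-reducible: for every central simple `F`-algebra `A` of exponent `p`
and every purely inseparable extension `K/F` with `K ^ p ⊆ F`, either `A_K` is split, or
there is a separable extension `L/F` of degree `ind (A_K) / p` with `ind A_{LK} = p`. -/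
def IsPReducible (p : ℕ) (F : Type) [Field F] : Prop :=
  ∀ (A : Type) [Ring A] [Algebra F A], IsCSA F A → HasExponent F A p →
  ∀ (K : Type) [Field K] [Algebra F K], IsPurelyInseparable F K →
    (∀ z : K, z ^ p ∈ (algebraMap F K).range) →
    IsSplitAlg K (K ⊗[F] A) ∨
    ∃ d : ℕ, HasIndex K (K ⊗[F] A) (p * d) ∧
      ∃ (L : Type) (_ : Field L) (_ : Algebra F L), Algebra.IsSeparable F L ∧
        Module.finrank F L = d ∧
        ∃ (M : Type) (_ : Field M) (_ : Algebra F M) (_ : Algebra L M) (_ : Algebra K M)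
          (_ : IsScalarTower F L M) (_ : IsScalarTower F K M),
          IsCompositum F L K M ∧ HasIndex M (M ⊗[F] A) p

section Weyl
variable {F X : Type} [Field F] [Ring X] [Algebra F X]

/-- If `T P - P T = 1`, then sums `∑ Pᵃ (g a)` with `a < p` and `T (g a) = 0` are direct. -/
lemma eq_zero_of_sum_pow_apply_eq_zero (p : ℕ) [Fact p.Prime] [CharP F p]
    (T P : X →ₗ[F] X) (hTP : ∀ y, T (P y) = P (T y) + y) (n : ℕ) (hn : n ≤ p) (g : ℕ → X)
    (hg : ∀ a, T (g a) = 0) (hsum : ∑ a ∈ Finset.range n, (P ^ a) (g a) = 0) :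
    ∀ a < n, g a = 0 := by
  induction n generalizing g with
  | zero => intro a ha; omega
  | succ n ih =>
    have hT : ∀ (a : ℕ) (y : X), T y = 0 → T ((P ^ (a + 1)) y) = (a + 1 : F) • (P ^ a) y := by
      intro a y hy
      induction a with
      | zero => simp [hTP, hy]
      | succ a iha =>
        rw [pow_succ', Module.End.mul_apply, hTP, iha, map_smul, ← Module.End.mul_apply,
          ← pow_succ']
        push_cast
        rw [add_smul (_ + 1 : F) 1, one_smul]
    have key := congrArg T hsum
    rw [map_sum, Finset.sum_range_succ', map_zero] at key
    simp only [pow_zero, Module.End.one_apply, hg, add_zero] at key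
    have hz := ih (by omega) (fun a => (a + 1 : F) • g (a + 1)) (by simp [hg]) (by
      rw [← key]
      exact Finset.sum_congr rfl fun a _ => by rw [hT a _ (hg _), map_smul])
    have hz' : ∀ a < n, g (a + 1) = 0 := fun a ha => by
      refine (smul_eq_zero.mp (hz a ha)).resolve_left fun h => ?_
      have h' : ((a + 1 : ℕ) : F) = 0 := by exact_mod_cast h
      rw [CharP.cast_eq_zero_iff F p] at h'
      exact absurd (Nat.le_of_dvd (by omega) h') (by omega)
    intro a ha
    cases a with
    | succ a => exact hz' a (by omega)
    | zero =>
      rw [Finset.sum_range_succ', Finset.sum_eq_zero] at hsum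
      · simpa using hsum
      · intro a ha'
        rw [hz' a (Finset.mem_range.mp ha'), map_zero]

/-- The monomials `uᵃ vᵇ` in a Weyl pair are independent over the centralizer of the pair. -/
lemma eq_zero_of_sum_weyl_monomials_eq_zero (p : ℕ) [Fact p.Prime] [CharP F p] (u v : X)
    (huv : u * v - v * u = 1) (w : Fin p → Fin p → X) (hu : ∀ a b, Commute u (w a b))
    (hv : ∀ a b, Commute v (w a b))
    (hsum : ∑ a : Fin p, ∑ b : Fin p, u ^ (a : ℕ) * v ^ (b : ℕ) * w a b = 0) : ∀ a b, w a b = 0 := by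
  have hpow : ∀ (y : X) (a : ℕ) (x : X),
      ((LinearMap.mulLeft F y) ^ a) x = y ^ a * x := by
    intro y a x
    rw [LinearMap.pow_mulLeft, LinearMap.mulLeft_apply]
  have huv' : u * v = v * u + 1 := by rw [← huv]; abel
  have hfst : ∀ a : Fin p, ∑ b : Fin p, v ^ (b : ℕ) * w a b = 0 := by
    let g : ℕ → X := fun a => if h : a < p then ∑ b : Fin p, v ^ (b : ℕ) * w ⟨a, h⟩ b else 0
    have := eq_zero_of_sum_pow_apply_eq_zero (F := F) p
      (LinearMap.mulRight F v - LinearMap.mulLeft F v) (LinearMap.mulLeft F u)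
      (fun y => by
        simp only [LinearMap.sub_apply, LinearMap.mulRight_apply, LinearMap.mulLeft_apply]
        rw [← mul_assoc v u, show v * u = u * v - 1 by rw [huv']; abel]
        noncomm_ring) p le_rfl g
      (fun a => by
        simp only [LinearMap.sub_apply, LinearMap.mulRight_apply, LinearMap.mulLeft_apply, g]
        split_ifs with h
        · rw [sub_eq_zero]
          exact (Commute.sum_right _ _ _ fun b _ =>
            ((Commute.refl v).pow_right _).mul_right (hv _ _)).eq.symm
        · simp)
      (by
        rw [← hsum, Finset.sum_range]
        refine Finset.sum_congr rfl fun a _ => ?_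
        simp only [hpow, g, a.2, dif_pos, Fin.eta, Finset.mul_sum, mul_assoc])
    intro a
    simpa [g] using this a a.2
  intro a b
  let g : ℕ → X := fun b => if h : b < p then w a ⟨b, h⟩ else 0
  have := eq_zero_of_sum_pow_apply_eq_zero (F := F) p
    (LinearMap.mulLeft F u - LinearMap.mulRight F u) (LinearMap.mulLeft F v)
    (fun y => by
      simp only [LinearMap.sub_apply, LinearMap.mulRight_apply, LinearMap.mulLeft_apply]
      rw [← mul_assoc u v, huv']
      noncomm_ring) p le_rfl g
    (fun b => by
      simp only [LinearMap.sub_apply, LinearMap.mulRight_apply, LinearMap.mulLeft_apply, g]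
      split_ifs with h
      · rw [sub_eq_zero]
        exact (hu _ _).eq
      · simp)
    (by
      rw [← hfst a, Finset.sum_range]
      refine Finset.sum_congr rfl fun b _ => ?_
      simp only [hpow, g, b.2, dif_pos, Fin.eta])
  simpa [g] using this b b.2

/-- Pairwise commuting Weyl pairs `(u k, v k)`. -/
structure IsWeylFamily {n : ℕ} (u v : Fin n → X) : Prop where
  pair : ∀ k, u k * v k - v k * u k = 1
  comm_uu : ∀ k l, Commute (u k) (u l)
  comm_vv : ∀ k l, Commute (v k) (v l)
  comm_uv : ∀ k l, k ≠ l → Commute (u k) (v l)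

/-- The ordered monomials `∏ₖ uₖᵃ vₖᵇ`. -/
def weylMonomial {n p : ℕ} (u v : Fin n → X) (α : Fin n → Fin p × Fin p) : X :=
  (List.ofFn fun k => u k ^ ((α k).1 : ℕ) * v k ^ ((α k).2 : ℕ)).prod

lemma Commute.weylMonomial {n p : ℕ} {u v : Fin n → X} {y : X} (hu : ∀ k, Commute y (u k))
    (hv : ∀ k, Commute y (v k)) (α : Fin n → Fin p × Fin p) :
    Commute y (weylMonomial u v α) := by
  refine Commute.list_prod_right _ _ fun x hx => ?_
  obtain ⟨k, rfl⟩ := (List.mem_ofFn' _ _).mp hx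
  exact ((hu k).pow_right _).mul_right ((hv k).pow_right _)

lemma IsWeylFamily.linearIndependent {n : ℕ} (p : ℕ) [Fact p.Prime] [CharP F p] [Nontrivial X]
    {u v : Fin n → X} (h : IsWeylFamily u v) :
    LinearIndependent F (weylMonomial u v : (Fin n → Fin p × Fin p) → X) := by
  rw [Fintype.linearIndependent_iff]
  induction n with
  | zero =>
    intro c hc α
    have : ∑ α, c α • weylMonomial u v α = c α • (1 : X) := by
      rw [Fintype.sum_subsingleton _ α]
      simp [weylMonomial]
    rw [this] at hc
    exact (smul_eq_zero.mp hc).resolve_right one_ne_zero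
  | succ n ih =>
    intro c hc
    have htail : IsWeylFamily (fun k : Fin n => u k.succ) (fun k => v k.succ) :=
      ⟨fun k => h.pair _, fun k l => h.comm_uu _ _, fun k l => h.comm_vv _ _,
        fun k l hkl => h.comm_uv _ _ (fun e => hkl (Fin.succ_injective _ e))⟩
    let w : Fin p → Fin p → X := fun a b =>
      ∑ β : Fin n → Fin p × Fin p, c (Fin.cons (a, b) β) •
        weylMonomial (fun k : Fin n => u k.succ) (fun k => v k.succ) β
    have hw : ∀ a b, w a b = 0 := by
      refine eq_zero_of_sum_weyl_monomials_eq_zero (F := F) p (u 0) (v 0) (h.pair 0) w ?_ ?_ ?_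
      · exact fun a b => Commute.sum_right _ _ _ fun β _ => Commute.smul_right
          (Commute.weylMonomial (fun k => h.comm_uu _ _)
            (fun k => h.comm_uv _ _ (Fin.succ_ne_zero k).symm) _) _
      · exact fun a b => Commute.sum_right _ _ _ fun β _ => Commute.smul_right
          (Commute.weylMonomial (fun k => (h.comm_uv _ _ (Fin.succ_ne_zero k)).symm)
            (fun k => h.comm_vv _ _) _) _
      · rw [← hc, ← (Fin.consEquiv (fun _ => Fin p × Fin p)).sum_comp, Fintype.sum_prod_type,
          Fintype.sum_prod_type]
        refine Finset.sum_congr rfl fun a _ => Finset.sum_congr rfl fun b _ => ?_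
        simp only [w, Finset.mul_sum]
        refine Finset.sum_congr rfl fun β _ => ?_
        simp [weylMonomial, List.ofFn_succ, Fin.consEquiv]
    intro α
    rw [← Fin.cons_self_tail α]
    exact ih htail (fun β => c (Fin.cons (α 0) β)) (hw (α 0).1 (α 0).2) _

end Weyl

section Weyl
variable {F X : Type} [Field F] [Ring X] [Algebra F X]

lemma weyl_pow_succ_mul {u v : X} (h : u * v - v * u = 1) (n : ℕ) :
    u ^ (n + 1) * v = v * u ^ (n + 1) + (n + 1 : X) * u ^ n := by
  have h' : u * v = v * u + 1 := by rw [← h]; abel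
  induction n with
  | zero => simp [h']
  | succ n ih =>
    rw [pow_succ' u (n + 1), mul_assoc, ih, mul_add, ← mul_assoc u v, h']
    have hc : u * ((n + 1 : X) * u ^ n) = (n + 1 : X) * u ^ (n + 1) := by
      rw [pow_succ' u n, ← mul_assoc, ← mul_assoc]
      congr 1
      exact_mod_cast (Nat.cast_commute (n + 1) u).eq.symm
    rw [hc]
    push_cast
    noncomm_ring

lemma weyl_commute_pow_char_left (p : ℕ) [Fact p.Prime] [CharP X p] {u v : X}
    (h : u * v - v * u = 1) : Commute (u ^ p) v := by
  obtain ⟨q, hq⟩ : ∃ q, p = q + 1 := ⟨p - 1, by have := (Fact.out : p.Prime).pos; omega⟩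
  have hz : ((q + 1 : ℕ) : X) = 0 := by rw [← hq]; exact CharP.cast_eq_zero X p
  have := weyl_pow_succ_mul h q
  rw [← hq] at this
  push_cast at hz
  rw [hz, zero_mul, add_zero] at this
  exact this

lemma weyl_commute_pow_char_right (p : ℕ) [Fact p.Prime] [CharP X p] {u v : X}
    (h : u * v - v * u = 1) : Commute (v ^ p) u := by
  have := weyl_commute_pow_char_left p (u := -v) (v := u) (by rw [← h]; noncomm_ring)
  rw [← neg_neg v, neg_pow]
  exact ((Commute.neg_one_left u).pow_left p).mul_left this

lemma exists_basis_adjoin_weyl_pair (p : ℕ) [Fact p.Prime] [CharP F p] {u v : X} [Nontrivial X]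
    (h : u * v - v * u = 1) (hu : ∃ α : F, u ^ p = algebraMap F X α)
    (hv : ∃ β : F, v ^ p = algebraMap F X β) :
    ∃ B : Module.Basis (Fin p × Fin p) F (Algebra.adjoin F {u, v}),
      ∀ ab, (B ab : X) = u ^ (ab.1 : ℕ) * v ^ (ab.2 : ℕ) := by
  have hp : 0 < p := (Fact.out : p.Prime).pos
  obtain ⟨α, hα⟩ := hu
  obtain ⟨β, hβ⟩ := hv
  let f : Fin p × Fin p → X := fun ab => u ^ (ab.1 : ℕ) * v ^ (ab.2 : ℕ)
  have hli : LinearIndependent F f := by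
    rw [Fintype.linearIndependent_iff]
    intro c hc ab
    have := eq_zero_of_sum_weyl_monomials_eq_zero (F := F) p u v h
      (fun a b => algebraMap F X (c (a, b)))
      (fun a b => (Algebra.commutes _ _).symm) (fun a b => (Algebra.commutes _ _).symm) (by
        rw [← hc, Fintype.sum_prod_type]
        refine Finset.sum_congr rfl fun a _ => Finset.sum_congr rfl fun b _ => ?_
        rw [Algebra.smul_def, Algebra.commutes]) ab.1 ab.2
    exact (map_eq_zero_iff _ (algebraMap F X).injective).mp this
  have hpow : ∀ {y : X} {γ : F}, y ^ p = algebraMap F X γ →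
      ∀ a : ℕ, y ^ a = γ ^ (a / p) • y ^ (a % p) := by
    intro y γ hy a
    conv_lhs => rw [← Nat.div_add_mod a p, pow_add, pow_mul, hy, ← map_pow, ← Algebra.smul_def]
  have hmem : ∀ a b : ℕ, u ^ a * v ^ b ∈ Submodule.span F (Set.range f) := by
    intro a b
    rw [hpow hα a, hpow hβ b, smul_mul_smul_comm]
    exact Submodule.smul_mem _ _ (Submodule.subset_span
      ⟨(⟨a % p, Nat.mod_lt _ hp⟩, ⟨b % p, Nat.mod_lt _ hp⟩), rfl⟩)
  have hclosed : ∀ x ∈ Algebra.adjoin F {u, v}, ∀ s ∈ Submodule.span F (Set.range f),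
      x * s ∈ Submodule.span F (Set.range f) := by
    intro x hx
    induction hx using Algebra.adjoin_induction with
    | mem x hx =>
      intro s hs
      induction hs using Submodule.span_induction with
      | mem s hs =>
        obtain ⟨⟨a, b⟩, rfl⟩ := hs
        rcases hx with rfl | rfl
        · simp only [f]
          rw [← mul_assoc, ← pow_succ']
          exact hmem _ _
        · simp only [f]
          obtain ⟨a, ha⟩ := a
          cases a with
          | zero =>
            rw [pow_zero, one_mul, ← pow_succ', ← one_mul (x ^ _), ← pow_zero u]
            exact hmem _ _
          | succ a =>
            have := weyl_pow_succ_mul h a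
            have e : x * (u ^ (a + 1) * x ^ (b : ℕ)) =
                u ^ (a + 1) * x ^ ((b : ℕ) + 1) - (a + 1 : F) • (u ^ a * x ^ (b : ℕ)) := by
              rw [pow_succ' x, ← mul_assoc, ← mul_assoc, this, add_mul, Algebra.smul_def]
              simp [mul_assoc]
            rw [e]
            exact Submodule.sub_mem _ (hmem _ _) (Submodule.smul_mem _ _ (hmem _ _))
      | zero => simp
      | add s t _ _ hs ht => rw [mul_add]; exact Submodule.add_mem _ hs ht
      | smul c s _ hs => rw [mul_smul_comm]; exact Submodule.smul_mem _ _ hs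
    | algebraMap r =>
      intro s hs
      rw [← Algebra.smul_def]
      exact Submodule.smul_mem _ _ hs
    | add x y _ _ hx hy =>
      intro s hs
      rw [add_mul]
      exact Submodule.add_mem _ (hx s hs) (hy s hs)
    | mul x y _ _ hx hy =>
      intro s hs
      rw [mul_assoc]
      exact hx _ (hy s hs)
  have huD : u ∈ Algebra.adjoin F {u, v} := Algebra.subset_adjoin (by simp)
  have hvD : v ∈ Algebra.adjoin F {u, v} := Algebra.subset_adjoin (by simp)
  have heq : Submodule.span F (Set.range f) = (Algebra.adjoin F {u, v}).toSubmodule := by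
    refine le_antisymm (Submodule.span_le.mpr ?_) fun x hx => ?_
    · rintro _ ⟨ab, rfl⟩
      exact Subalgebra.mul_mem _ (Subalgebra.pow_mem _ huD _) (Subalgebra.pow_mem _ hvD _)
    · simpa using hclosed x hx 1 (by simpa using hmem 0 0)
  refine ⟨(Module.Basis.span hli).map (LinearEquiv.ofEq _ _ heq), fun ab => ?_⟩
  rw [Module.Basis.map_apply]
  exact congrArg Subtype.val (Module.Basis.span_apply hli ab)

/-- The product map of a commuting family of subalgebras, out of their tensor product. -/
lemma exists_piTensorProduct_algHom {n : ℕ} (D : Fin n → Subalgebra F X)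
    (hD : ∀ k l, k ≠ l → ∀ x ∈ D k, ∀ y ∈ D l, Commute x y) :
    ∃ Φ : (⨂[F] k, D k) →ₐ[F] X, ∀ x : ∀ k, D k,
      Φ (PiTensorProduct.tprod F x) = (List.ofFn fun k => (x k : X)).prod := by
  have hmul : ∀ (n : ℕ) (x y : Fin n → X), (∀ k l, k ≠ l → Commute (x k) (y l)) →
      (List.ofFn fun k => x k * y k).prod = (List.ofFn x).prod * (List.ofFn y).prod := by
    intro n
    induction n with
    | zero => simp
    | succ n ih =>
      intro x y hxy
      simp only [List.ofFn_succ, List.prod_cons]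
      rw [ih _ _ fun k l hkl => hxy _ _ (fun e => hkl (Fin.succ_injective _ e))]
      have : Commute (y 0) (List.ofFn fun k : Fin n => x k.succ).prod := by
        refine Commute.list_prod_right _ _ fun z hz => ?_
        obtain ⟨k, rfl⟩ := (List.mem_ofFn' _ _).mp hz
        exact (hxy _ _ (Fin.succ_ne_zero k)).symm
      rw [mul_assoc, ← mul_assoc (y 0), this.eq]
      simp only [mul_assoc]
  let m : MultilinearMap F (fun k => D k) X :=
    (MultilinearMap.mkPiAlgebraFin F n X).compLinearMap fun k => (D k).val.toLinearMap
  have hm : ∀ x, m x = (List.ofFn fun k => (x k : X)).prod := fun x => by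
    simp [m, MultilinearMap.mkPiAlgebraFin_apply]
  refine ⟨PiTensorProduct.liftAlgHom m (by rw [hm]; simp [List.ofFn_const]) (fun x y => ?_), ?_⟩
  · rw [hm, hm, hm]
    exact hmul n _ _ fun k l hkl => hD k l hkl _ (x k).2 _ (y l).2
  · exact fun x => (PiTensorProduct.lift.tprod (φ := m) x).trans (hm x)

end Weyl

section Weyl
variable {F X : Type} [Field F] [Ring X] [Algebra F X]

lemma IsWeylFamily.exists_algebraMap_eq {n : ℕ} (p : ℕ) [Fact p.Prime] [CharP F p] [Nontrivial X]
    [Algebra.IsCentral F X] (hX : Module.finrank F X = (p ^ 2) ^ n) {u v : Fin n → X}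
    (h : IsWeylFamily u v) {y : X} (hu : ∀ k, Commute y (u k)) (hv : ∀ k, Commute y (v k)) :
    ∃ r : F, y = algebraMap F X r := by
  have : FiniteDimensional F X := Module.finite_of_finrank_pos (by
    rw [hX]; have := (Fact.out : p.Prime).pos; positivity)
  have hspan : Submodule.span F (Set.range (weylMonomial u v : (Fin n → Fin p × Fin p) → X)) = ⊤ :=
    (h.linearIndependent p).span_eq_top_of_card_eq_finrank' (by simp [hX, sq])
  refine Algebra.IsCentral.mem_center_iff F |>.mp (Subalgebra.mem_center_iff.mpr fun x => ?_)
  have hx : x ∈ Submodule.span F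
      (Set.range (weylMonomial u v : (Fin n → Fin p × Fin p) → X)) := hspan ▸ Submodule.mem_top
  refine (?_ : Commute x y)
  induction hx using Submodule.span_induction with
  | mem x hx => obtain ⟨α, rfl⟩ := hx; exact (Commute.weylMonomial hu hv α).symm
  | zero => exact Commute.zero_left _
  | add x z _ _ hx hz => exact hx.add_left hz
  | smul c x _ hx => exact hx.smul_left c

/-- A central algebra of dimension `p ^ (2 n)` containing `n` commuting Weyl pairs is a tensor
product of `n` cyclic algebras of degree `p`. -/
theorem IsWeylFamily.exists_decomposition {n : ℕ} (p : ℕ) [Fact p.Prime] [CharP F p]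
    [Nontrivial X] [Algebra.IsCentral F X] (hX : Module.finrank F X = (p ^ 2) ^ n)
    {u v : Fin n → X} (h : IsWeylFamily u v) :
    ∃ D : Fin n → Subalgebra F X, (∀ k, IsCyclicPAlg p F (D k)) ∧
      Nonempty ((⨂[F] k, D k) ≃ₐ[F] X) := by
  have hp : p.Prime := Fact.out
  have : CharP X p := charP_of_injective_algebraMap (algebraMap F X).injective p
  wlog hj : ∀ k, v k ^ p ≠ 0 generalizing v with H
  · classical
    refine H (v := fun k => if v k ^ p = 0 then v k + 1 else v k) ⟨?_, h.comm_uu, ?_, ?_⟩ ?_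
    · intro k
      split_ifs
      · rw [mul_add, add_mul, mul_one, one_mul, add_sub_add_right_eq_sub, h.pair k]
      · exact h.pair k
    · intro k l
      have := h.comm_vv k l
      split_ifs <;>
      simp [Commute.add_left, Commute.add_right, Commute.one_left, Commute.one_right, this]
    · intro k l hkl
      have := h.comm_uv k l hkl
      split_ifs <;> simp [Commute.add_right, Commute.one_right, this]
    · intro k
      split_ifs with h0
      · rw [add_pow_char_of_commute _ (Commute.one_right _), h0]
        simp
      · exact h0
  have hup : ∀ k, ∃ r : F, u k ^ p = algebraMap F X r := fun k =>
    h.exists_algebraMap_eq p hX (fun l => (h.comm_uu k l).pow_left p) fun l => by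
      rcases eq_or_ne k l with rfl | hkl
      · exact weyl_commute_pow_char_left p (h.pair k)
      · exact (h.comm_uv k l hkl).pow_left p
  have hvp : ∀ k, ∃ r : F, v k ^ p = algebraMap F X r := fun k =>
    h.exists_algebraMap_eq p hX (fun l => by
      rcases eq_or_ne l k with rfl | hkl
      · exact weyl_commute_pow_char_right p (h.pair l)
      · exact (h.comm_uv l k hkl).symm.pow_left p) (fun l => (h.comm_vv k l).pow_left p)
  have hij : ∀ k, (v k * u k) * v k = v k * (v k * u k + 1) := fun k => by
    have : u k * v k = v k * u k + 1 := by rw [← h.pair k]; abel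
    rw [mul_assoc, this]
  have hui : ∀ k, u k * (v k * u k) = (v k * u k + 1) * u k := fun k => by
    have : u k * v k = v k * u k + 1 := by rw [← h.pair k]; abel
    rw [← mul_assoc, this]
  have hip : ∀ k, ∃ r : F, (v k * u k) ^ p - v k * u k = algebraMap F X r := fun k => by
    have hadd : (v k * u k + 1) ^ p = (v k * u k) ^ p + 1 := by
      rw [add_pow_char_of_commute _ (Commute.one_right _), one_pow]
    refine h.exists_algebraMap_eq p hX (fun l => ?_) fun l => ?_
    · rcases eq_or_ne k l with rfl | hkl
      · have e : u k * (v k * u k) ^ p = (v k * u k + 1) ^ p * u k :=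
          SemiconjBy.pow_right (hui k) p
        refine (?_ : _ = _)
        rw [mul_sub, e, hadd, hui k]
        noncomm_ring
      · have c : Commute (v k * u k) (u l) := (h.comm_uv l k hkl.symm).symm.mul_left (h.comm_uu k l)
        exact (c.pow_left p).sub_left c
    · rcases eq_or_ne k l with rfl | hkl
      · have e : v k * (v k * u k + 1) ^ p = (v k * u k) ^ p * v k :=
          SemiconjBy.pow_right (hij k).symm p
        refine (?_ : _ = _)
        rw [sub_mul, ← e, hadd, hij k]
        noncomm_ring
      · have c : Commute (v k * u k) (v l) := (h.comm_vv k l).mul_left (h.comm_uv k l hkl)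
        exact (c.pow_left p).sub_left c
  let D : Fin n → Subalgebra F X := fun k => Algebra.adjoin F {u k, v k}
  choose B hB using fun k => exists_basis_adjoin_weyl_pair p (h.pair k) (hup k) (hvp k)
  have huD : ∀ k, u k ∈ D k := fun k => Algebra.subset_adjoin (by simp)
  have hvD : ∀ k, v k ∈ D k := fun k => Algebra.subset_adjoin (by simp)
  refine ⟨D, fun k => ?_, ?_⟩
  · obtain ⟨β, hβ⟩ := hvp k
    obtain ⟨γ, hγ⟩ := hip k
    have hβ0 : β ≠ 0 := by rintro rfl; exact hj k (by simpa using hβ)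
    refine ⟨γ, β, hβ0, ?_, ⟨v k * u k, mul_mem (hvD k) (huD k)⟩, ⟨v k, hvD k⟩,
      Subtype.ext hγ, Subtype.ext hβ, Subtype.ext ?_, ?_⟩
    · rw [Module.finrank_eq_card_basis (B k)]
      simp [sq]
    · change v k * (v k * u k) = (v k * u k - 1) * v k
      rw [sub_mul, hij k]
      noncomm_ring
    · apply Subalgebra.map_injective (f := (D k).val) Subtype.val_injective
      rw [AlgHom.map_adjoin, Set.image_pair, Algebra.map_top, Subalgebra.range_val]
      refine le_antisymm (Algebra.adjoin_le ?_) (Algebra.adjoin_le ?_)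
      · rintro x (rfl | rfl)
        · exact mul_mem (hvD k) (huD k)
        · exact hvD k
      · have hv' : v k ∈ Algebra.adjoin F {v k * u k, v k} := Algebra.subset_adjoin (by simp)
        rintro x (rfl | rfl)
        · have e : u k = β⁻¹ • (v k ^ (p - 1) * (v k * u k)) := by
            rw [← mul_assoc, ← pow_succ, Nat.sub_add_cancel hp.one_le, hβ, ← Algebra.smul_def,
              smul_smul, inv_mul_cancel₀ hβ0, one_smul]
          have := Subalgebra.smul_mem _ (mul_mem (pow_mem hv' (p - 1))
            (Algebra.subset_adjoin (R := F) (s := {v k * u k, v k})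
              (Set.mem_insert (v k * u k) _))) β⁻¹
          rwa [← e] at this
        · exact hv'
  · obtain ⟨Φ, hΦ⟩ := exists_piTensorProduct_algHom D (fun k l hkl x hx y hy => by
      refine Algebra.commute_of_mem_adjoin_of_forall_mem_commute (R := F) (s := {u l, v l}) hy
        fun b hb => (Algebra.commute_of_mem_adjoin_of_forall_mem_commute
          (R := F) (s := {u k, v k}) hx fun a ha => ?_).symm
      rcases ha with rfl | rfl <;> rcases hb with rfl | rfl
      · exact h.comm_uu _ _
      · exact (h.comm_uv _ _ hkl).symm
      · exact h.comm_uv _ _ hkl.symm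
      · exact h.comm_vv _ _)
    let Bt := Basis.piTensorProduct B
    have hfin : Module.finrank F (⨂[F] k, D k) = Module.finrank F X := by
      rw [Module.finrank_eq_card_basis Bt, hX]
      simp [sq]
    have hcomp : Φ.toLinearMap ∘ Bt = weylMonomial u v := by
      funext α
      simp only [Function.comp_apply, Bt, Basis.piTensorProduct_apply,
        AlgHom.toLinearMap_apply, hΦ, hB, weylMonomial]
    have hinj : Function.Injective Φ.toLinearMap := by
      have hli : LinearIndependent F (Φ.toLinearMap ∘ Bt) := hcomp ▸ h.linearIndependent p
      exact LinearMap.injective_of_linearIndependent Bt.span_eq hli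
    have : FiniteDimensional F X := Module.finite_of_finrank_pos (by
      rw [hX]; have := hp.pos; positivity)
    have : FiniteDimensional F (⨂[F] k, D k) := Module.Finite.of_basis Bt
    exact ⟨AlgEquiv.ofBijective Φ
      ⟨hinj, (LinearMap.injective_iff_surjective_of_finrank_eq_finrank hfin).mp hinj⟩⟩

end Weyl

section Modules
variable {F B V V' : Type} [Field F] [Ring B] [Algebra F B]
  [AddCommGroup V] [AddCommGroup V'] [Module F V'] [Module F V]

/-- Over a finite-dimensional simple algebra, finite-dimensional modules of the same dimension are
isomorphic. -/
lemma nonempty_linearEquiv_of_isSimpleRing [IsSimpleRing B] [FiniteDimensional F B]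
    [Module B V] [IsScalarTower F B V] [Module B V'] [IsScalarTower F B V']
    [FiniteDimensional F V] [FiniteDimensional F V']
    (h : Module.finrank F V = Module.finrank F V') : Nonempty (V ≃ₗ[B] V') := by
  have : IsArtinianRing B := IsArtinianRing.of_finite F B
  have : IsSemisimpleRing B := IsSimpleRing.isSemisimpleRing_iff_isArtinianRing.mpr ‹_›
  have : Module.Finite B V := Module.Finite.of_restrictScalars_finite F B V
  have : Module.Finite B V' := Module.Finite.of_restrictScalars_finite F B V'
  rcases subsingleton_or_nontrivial V with hV | hV
  · have : Subsingleton V' := by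
      rw [← Module.finrank_zero_iff (R := F), ← h, Module.finrank_zero_of_subsingleton]
    exact ⟨0⟩
  obtain ⟨S, hS⟩ := IsAtomic.exists_atom (Submodule B V)
  rw [← isSimpleModule_iff_isAtom] at hS
  let S' := S.map (LinearMap.inl B V V')
  let e : S ≃ₗ[B] S' := S.equivMapOfInjective _ LinearMap.inl_injective
  have : IsSimpleModule B S' := IsSimpleModule.congr e.symm
  have hW : IsIsotypicOfType B (V × V') S' := IsSimpleRing.isIsotypic B (V × V') S'
  obtain ⟨n, ⟨f⟩⟩ := (hW.of_injective _
    (LinearMap.inl_injective (R := B) (M := V) (M₂ := V'))).linearEquiv_fun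
  obtain ⟨n', ⟨f'⟩⟩ := (hW.of_injective _
    (LinearMap.inr_injective (R := B) (M := V) (M₂ := V'))).linearEquiv_fun
  have : Nontrivial S' := IsSimpleModule.nontrivial B S'
  have : FiniteDimensional F S' := FiniteDimensional.of_injective
    ((Submodule.subtype S').restrictScalars F) Subtype.val_injective
  have hpos : 0 < Module.finrank F S' := Module.finrank_pos
  have h1 := (f.restrictScalars F).finrank_eq
  have h2 := (f'.restrictScalars F).finrank_eq
  rw [Module.finrank_pi_fintype] at h1 h2
  simp only [Finset.sum_const, Finset.card_univ, Fintype.card_fin, smul_eq_mul] at h1 h2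
  have : n = n' := Nat.eq_of_mul_eq_mul_right hpos (by rw [← h1, ← h2, h])
  subst this
  exact ⟨f.trans f'.symm⟩

lemma exists_intertwiner [IsSimpleRing B] [FiniteDimensional F B]
    [FiniteDimensional F V] [FiniteDimensional F V'] (ρ : B →ₐ[F] Module.End F V)
    (ρ' : B →ₐ[F] Module.End F V') (h : Module.finrank F V = Module.finrank F V') :
    ∃ e : V ≃ₗ[F] V', ∀ b v, e (ρ b v) = ρ' b (e v) := by
  let _ : Module B V := Module.compHom V (ρ : B →+* Module.End F V)
  let _ : Module B V' := Module.compHom V' (ρ' : B →+* Module.End F V')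
  have : IsScalarTower F B V := ⟨fun c b v => by
    change ρ (c • b) v = c • ρ b v
    rw [map_smul, LinearMap.smul_apply]⟩
  have : IsScalarTower F B V' := ⟨fun c b v => by
    change ρ' (c • b) v = c • ρ' b v
    rw [map_smul, LinearMap.smul_apply]⟩
  obtain ⟨e⟩ := nonempty_linearEquiv_of_isSimpleRing (F := F) (B := B) h
  exact ⟨e.restrictScalars F, fun b v => e.map_smul b v⟩

end Modules

section Transfer
variable {F C V : Type} [Field F] [Ring C] [Algebra F C] [AddCommGroup V] [Module F V]

lemma IsWeylFamily.of_injective {X Y : Type} [Ring X] [Ring Y] {k : ℕ} {u v : Fin k → X}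
    (f : X →+* Y) (hf : Function.Injective f)
    (h : IsWeylFamily (fun i => f (u i)) (fun i => f (v i))) : IsWeylFamily u v where
  pair i := hf (by simpa using h.pair i)
  comm_uu i j := hf (by simpa using (h.comm_uu i j).eq)
  comm_vv i j := hf (by simpa using (h.comm_vv i j).eq)
  comm_uv i j hij := hf (by simpa using (h.comm_uv i j hij).eq)

lemma IsWeylFamily.map {X Y : Type} [Ring X] [Ring Y] {k : ℕ} {u v : Fin k → X}
    (f : X →+* Y) (h : IsWeylFamily u v) :
    IsWeylFamily (fun i => f (u i)) (fun i => f (v i)) where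
  pair i := by rw [← map_mul, ← map_mul, ← map_sub, h.pair, map_one]
  comm_uu i j := (h.comm_uu i j).map f
  comm_vv i j := (h.comm_vv i j).map f
  comm_uv i j hij := (h.comm_uv i j hij).map f

/-- Square matrices over an algebra acting on column vectors. -/
noncomputable def matrixMulVecHom (F C : Type) [Field F] [Ring C] [Algebra F C] (n : ℕ) :
    Matrix (Fin n) (Fin n) C →+* Module.End F (Fin n → C) where
  toFun m :=
    { toFun := fun x => m.mulVec x
      map_add' := fun x y => Matrix.mulVec_add m x y
      map_smul' := fun c x => Matrix.mulVec_smul m c x }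
  map_one' := LinearMap.ext fun x => Matrix.one_mulVec x
  map_mul' a b := LinearMap.ext fun x => (Matrix.mulVec_mulVec x a b).symm
  map_zero' := LinearMap.ext fun x => Matrix.zero_mulVec x
  map_add' a b := LinearMap.ext fun x => Matrix.add_mulVec a b x

lemma matrixMulVecHom_injective (n : ℕ) : Function.Injective (matrixMulVecHom F C n) := by
  intro a b h
  ext i j
  have := congrFun (LinearMap.congr_fun h (Pi.single j 1)) i
  simpa [matrixMulVecHom] using this

lemma exists_matrixMulVecHom_eq {n : ℕ} (T : Module.End F (Fin n → C))
    (hT : ∀ (c : C) (x : Fin n → C), T (fun i => x i * c) = fun i => T x i * c) :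
    ∃ m, matrixMulVecHom F C n m = T := by
  refine ⟨fun i j => T (Pi.single j 1) i, ?_⟩
  refine LinearMap.ext fun x => ?_
  have hx : x = ∑ j, fun i => (Pi.single j (1 : C) : Fin n → C) i * x j := by
    funext i
    simp [Finset.sum_apply, Pi.single_apply]
  conv_rhs => rw [hx, map_sum]
  simp_rw [hT]
  funext i
  simp [matrixMulVecHom, Matrix.mulVec, dotProduct, Finset.sum_apply]

/-- A Weyl family commuting with an action of `Cᵐᵒᵖ` lives in a matrix algebra over `C`. -/
lemma IsWeylFamily.exists_matrix [IsSimpleRing C] [FiniteDimensional F C] [FiniteDimensional F V]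
    {k n : ℕ} (ρ : Cᵐᵒᵖ →ₐ[F] Module.End F V)
    (hn : Module.finrank F V = n * Module.finrank F C) {u v : Fin k → Module.End F V}
    (h : IsWeylFamily u v) (hu : ∀ i c, Commute (u i) (ρ c)) (hv : ∀ i c, Commute (v i) (ρ c)) :
    ∃ u' v' : Fin k → Matrix (Fin n) (Fin n) C, IsWeylFamily u' v' := by
  let ρ' : Cᵐᵒᵖ →ₐ[F] Module.End F (Fin n → C) := Algebra.lsmul F F (Fin n → C)
  obtain ⟨e, he⟩ := exists_intertwiner ρ ρ' (by simp [hn, Module.finrank_pi_fintype])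
  have key : ∀ T : Module.End F V, (∀ c, Commute T (ρ c)) →
      ∃ m, matrixMulVecHom F C n m = e.conjAlgEquiv F T := fun T hT => by
    refine exists_matrixMulVecHom_eq _ fun c x => ?_
    have h1 : (fun i => x i * c) = ρ' (MulOpposite.op c) x := rfl
    have h2 : ∀ y, e.symm (ρ' (MulOpposite.op c) y) = ρ (MulOpposite.op c) (e.symm y) := fun y => by
      rw [LinearEquiv.symm_apply_eq, he, LinearEquiv.apply_symm_apply]
    have h3 : ∀ y, T (ρ (MulOpposite.op c) y) = ρ (MulOpposite.op c) (T y) := fun y =>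
      LinearMap.congr_fun (hT (MulOpposite.op c)) y
    rw [h1]
    simp only [LinearEquiv.conjAlgEquiv_apply, LinearMap.comp_apply, LinearEquiv.coe_coe, h2, h3, he]
    rfl
  choose u' hu' using fun i => key (u i) (hu i)
  choose v' hv' using fun i => key (v i) (hv i)
  refine ⟨u', v', IsWeylFamily.of_injective (matrixMulVecHom F C n) (matrixMulVecHom_injective n) ?_⟩
  simp_rw [hu', hv']
  exact h.map ((e.conjAlgEquiv F).toRingEquiv.toRingHom)

end Transfer

section SkolemNoether
variable {F C L : Type} [Field F] [Ring C] [Algebra F C] [Field L] [Algebra F L]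

lemma mulLeftRight_surjective [Algebra.IsCentral F C] [IsSimpleRing C] [FiniteDimensional F C] :
    Function.Surjective (AlgHom.mulLeftRight F C) := by
  classical
  intro f
  let _ : Module (C ⊗[F] Cᵐᵒᵖ) C :=
    Module.compHom C (AlgHom.mulLeftRight F C : C ⊗[F] Cᵐᵒᵖ →+* Module.End F C)
  have hsmul : ∀ (a b x : C), (a ⊗ₜ[F] MulOpposite.op b) • x = a * x * b := fun a b x =>
    AlgHom.mulLeftRight_apply F C a (MulOpposite.op b) x
  have hsimple : IsSimpleModule (C ⊗[F] Cᵐᵒᵖ) C := by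
    refine (isSimpleModule_iff _ _).mpr ⟨fun N => ?_⟩
    let I : Ideal C :=
      { carrier := N
        add_mem' := N.add_mem
        zero_mem' := N.zero_mem
        smul_mem' := fun c x hx => by
          have := N.smul_mem (c ⊗ₜ[F] MulOpposite.op 1) hx
          rwa [hsmul, mul_one] at this }
    have hI : I.IsTwoSided := ⟨fun {a} b ha => by
      have := N.smul_mem (1 ⊗ₜ[F] MulOpposite.op b) ha
      rwa [hsmul, one_mul] at this⟩
    refine ((isSimpleRing_iff_isTwoSided_imp.mp ‹_›).2 I hI).imp (fun h => ?_) (fun h => ?_) <;>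
    · ext x
      change x ∈ I ↔ _
      rw [h]
      simp
  have hend : ∀ φ : Module.End (C ⊗[F] Cᵐᵒᵖ) C, ∃ r : F, ∀ x, φ x = r • x := fun φ => by
    have h1 : ∀ a b x, φ (a * x * b) = a * φ x * b := fun a b x => by
      rw [← hsmul, map_smul, hsmul]
    have h2 : φ 1 ∈ Subalgebra.center F C := Subalgebra.mem_center_iff.mpr fun b => by
      have e1 := h1 b 1 1
      have e2 := h1 1 b 1
      simp only [mul_one, one_mul] at e1 e2
      rw [← e1, ← e2]
    obtain ⟨r, hr⟩ := (Algebra.IsCentral.mem_center_iff F).mp h2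
    refine ⟨r, fun x => ?_⟩
    have := h1 1 x 1
    rw [one_mul, one_mul, one_mul] at this
    rw [this, hr, Algebra.smul_def]
  let g : Module.End (Module.End (C ⊗[F] Cᵐᵒᵖ) C) C :=
    { f with
      map_smul' := fun φ x => by
        obtain ⟨r, hr⟩ := hend φ
        change f (φ x) = φ (f x)
        rw [hr, hr, map_smul] }
  let b := Module.finBasis F C
  obtain ⟨t, ht⟩ := jacobson_density g (Finset.univ.image b)
  refine ⟨t, b.ext fun i => ?_⟩
  exact (ht (b i) (Finset.mem_image_of_mem _ (Finset.mem_univ i))).symm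

lemma isSimpleRing_tensorProduct_field [Algebra.IsCentral F C] [IsSimpleRing C]
    [FiniteDimensional F C] : IsSimpleRing (C ⊗[F] L) := by
  refine isSimpleRing_iff_isTwoSided_imp.mpr ⟨inferInstance, fun I hI => ?_⟩
  refine or_iff_not_imp_left.mpr fun hbot => ?_
  obtain ⟨x, hxI, hx0⟩ := Submodule.exists_mem_ne_zero_of_ne_bot hbot
  have hmem : ∀ f : C →ₗ[F] C, f.rTensor L x ∈ I := fun f => by
    obtain ⟨t, rfl⟩ := mulLeftRight_surjective f
    induction t with
    | zero => simp
    | add t s ht hs => rw [map_add, LinearMap.rTensor_add]; exact I.add_mem ht hs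
    | tmul a b =>
      have : (AlgHom.mulLeftRight F C (a ⊗ₜ b)).rTensor L x =
          (a ⊗ₜ[F] (1 : L)) * x * (b.unop ⊗ₜ[F] (1 : L)) := by
        clear hxI hx0
        induction x with
        | zero => simp
        | add x y hx hy => rw [map_add, mul_add, add_mul, hx, hy]
        | tmul c l => simp [AlgHom.mulLeftRight_apply]
      rw [this]
      exact I.mul_mem_right _ (I.mul_mem_left _ hxI)
  let b := Module.finBasis F C
  let co : Fin (Module.finrank F C) → C ⊗[F] L →ₗ[F] L := fun i =>
    (TensorProduct.lid F L).toLinearMap ∘ₗ (b.coord i).rTensor L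
  have hco : ∀ (i) (y : C ⊗[F] L),
      (Algebra.linearMap F C ∘ₗ b.coord i).rTensor L y = 1 ⊗ₜ[F] co i y := fun i y => by
    induction y with
    | zero => simp
    | add x y hx hy => rw [map_add, hx, hy, map_add, TensorProduct.tmul_add]
    | tmul c l => simp [co, Algebra.algebraMap_eq_smul_one, TensorProduct.smul_tmul]
  have hsum : ∀ y : C ⊗[F] L, y = ∑ i, b i ⊗ₜ[F] co i y := fun y => by
    induction y with
    | zero => simp
    | add x y hx hy =>
      conv_lhs => rw [hx, hy]
      simp_rw [map_add, TensorProduct.tmul_add, Finset.sum_add_distrib]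
    | tmul c l =>
      conv_lhs => rw [← b.sum_repr c, TensorProduct.sum_tmul]
      simp [co, TensorProduct.smul_tmul]
  obtain ⟨i, hi⟩ : ∃ i, co i x ≠ 0 := by
    by_contra! h
    exact hx0 (by rw [hsum x]; simp [h])
  have h1 := hmem (Algebra.linearMap F C ∘ₗ b.coord i)
  rw [hco] at h1
  rw [Ideal.eq_top_iff_one]
  have := I.mul_mem_left (1 ⊗ₜ[F] (co i x)⁻¹) h1
  rwa [Algebra.TensorProduct.tmul_mul_tmul, one_mul, inv_mul_cancel₀ hi] at this

/-- Skolem–Noether for a commutative subfield. -/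
lemma exists_unit_conj_eq [Algebra.IsCentral F C] [IsSimpleRing C] [FiniteDimensional F C]
    [FiniteDimensional F L] (i : L →ₐ[F] C) (σ : L →ₐ[F] L) :
    ∃ z : Cˣ, ∀ l, (z : C) * i l = i (σ l) * z := by
  have := isSimpleRing_tensorProduct_field (F := F) (C := C) (L := L)
  let R : (L →ₐ[F] C) → L →ₐ[F] Module.End F C := fun j =>
    AlgHom.ofLinearMap ((LinearMap.mul F C).flip ∘ₗ j.toLinearMap)
      (LinearMap.ext fun x => by simp)
      (fun l m => LinearMap.ext fun x => by
        simp [mul_comm l m, mul_assoc])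
  have hR : ∀ j l x, R j l x = x * j l := fun _ _ _ => rfl
  let ρ : (L →ₐ[F] C) → C ⊗[F] L →ₐ[F] Module.End F C := fun j =>
    Algebra.TensorProduct.lift (Algebra.lmul F C) (R j)
      fun c l => LinearMap.ext fun x => by simp [hR, mul_assoc]
  have hρ : ∀ j c l x, ρ j (c ⊗ₜ l) x = c * (x * j l) := fun j c l x => by
    have : ρ j (c ⊗ₜ l) = Algebra.lmul F C c * R j l := Algebra.TensorProduct.lift_tmul _ _ _ c l
    rw [this]
    rfl
  obtain ⟨e, he⟩ := exists_intertwiner (ρ i) (ρ (i.comp σ)) rfl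
  have h1 : ∀ x, e x = x * e 1 := fun x => by
    have := he (x ⊗ₜ 1) 1
    rwa [hρ, hρ, map_one i, map_one (i.comp σ), mul_one, mul_one, mul_one] at this
  obtain ⟨w, hw⟩ := e.surjective 1
  have hw1 : w * e 1 = 1 := by rw [← h1, hw]
  have hw2 : e 1 * w = 1 := e.injective (by rw [h1, mul_assoc, hw1, mul_one])
  refine ⟨⟨w, e 1, hw1, hw2⟩, fun l => ?_⟩
  have h2 : i l * e 1 = e 1 * i (σ l) := by
    have := he (1 ⊗ₜ l) 1
    rw [hρ, hρ, one_mul, one_mul, one_mul, h1] at this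
    exact this
  change w * i l = i (σ l) * w
  calc w * i l = w * (i l * e 1) * w := by rw [mul_assoc, mul_assoc, hw2, mul_one]
    _ = i (σ l) * w := by rw [h2, ← mul_assoc, hw1, one_mul]

end SkolemNoether

section CyclicData
variable {F C L E : Type} [Field F] [Ring C] [Algebra F C] [Field L] [Algebra F L]
  [Ring E] [Algebra F E]

lemma exists_pow_apply_injective [FiniteDimensional F L] [Algebra.IsSeparable F L]
    (σ : L ≃ₐ[F] L) :
    ∃ a : L, Function.Injective fun k : Fin (orderOf σ) => (σ ^ (k : ℕ)) a := by
  let pb := Field.powerBasisOfFiniteOfSeparable F L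
  refine ⟨pb.gen, fun j k hjk => ?_⟩
  have h : (σ ^ (j : ℕ)) = σ ^ (k : ℕ) := by
    have := pb.algHom_ext (f := ((σ ^ (j : ℕ) : L ≃ₐ[F] L) : L →ₐ[F] L))
      (g := ((σ ^ (k : ℕ) : L ≃ₐ[F] L) : L →ₐ[F] L)) hjk
    ext x
    exact DFunLike.congr_fun this x
  exact Fin.ext (pow_injOn_Iio_orderOf j.2 k.2 h)

lemma pow_mul_apply_of_semilinear {C : Type} [Ring C] {i : L → C} {σ : L ≃ₐ[F] L} {z : C}
    (h : ∀ l, z * i l = i (σ l) * z) (k : ℕ) (l : L) :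
    z ^ k * i l = i ((σ ^ k) l) * z ^ k := by
  induction k generalizing l with
  | zero => simp
  | succ k ih => rw [pow_succ z, mul_assoc, h, ← mul_assoc, ih, mul_assoc, pow_succ σ,
      AlgEquiv.mul_apply]

lemma bijective_sum_mul_pow [FiniteDimensional F L] [Algebra.IsSeparable F L] [Nontrivial C]
    [FiniteDimensional F C] (i : L →ₐ[F] C) (σ : L ≃ₐ[F] L)
    (hσ : orderOf σ = Module.finrank F L) (hC : Module.finrank F C = Module.finrank F L ^ 2)
    (z : Cˣ) (h : ∀ l, (z : C) * i l = i (σ l) * z) :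
    Function.Bijective fun f : Fin (Module.finrank F L) → L => ∑ k, i (f k) * (z : C) ^ (k : ℕ) := by
  let _ : Module L C := Module.compHom C (i : L →+* C)
  have hsmul : ∀ (l : L) (c : C), l • c = i l * c := fun _ _ => rfl
  obtain ⟨a, ha⟩ := exists_pow_apply_injective σ
  rw [hσ] at ha
  let R : Module.End L C :=
    { toFun := fun c => c * i a
      map_add' := fun x y => add_mul x y _
      map_smul' := fun l x => mul_assoc (i l) x (i a) }
  have hli : LinearIndependent L fun k : Fin (Module.finrank F L) => (z : C) ^ (k : ℕ) := by
    refine Module.End.eigenvectors_linearIndependent' R _ ha _ fun k => ⟨?_, ?_⟩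
    · rw [Module.End.mem_eigenspace_iff, hsmul]
      exact pow_mul_apply_of_semilinear h k a
    · rw [← Units.val_pow_eq_pow_val]
      exact Units.ne_zero _
  let φ : (Fin (Module.finrank F L) → L) →ₗ[F] C :=
    { toFun := fun f => ∑ k, i (f k) * (z : C) ^ (k : ℕ)
      map_add' := fun f g => by simp [add_mul, Finset.sum_add_distrib]
      map_smul' := fun r f => by simp [Finset.smul_sum] }
  have hinj : Function.Injective φ := by
    rw [← LinearMap.ker_eq_bot, LinearMap.ker_eq_bot']
    exact fun f hf => funext (Fintype.linearIndependent_iff.mp hli f hf)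
  refine ⟨hinj, (LinearMap.injective_iff_surjective_of_finrank_eq_finrank ?_).mp hinj⟩
  rw [Module.finrank_pi_fintype, hC]
  simp [sq]

/-- `C` is the cyclic algebra `⊕ L zᵏ` with `z l = σ(l) z` and `z ^ [L : F] = b`. -/
structure IsCyclicPresentation (i : L →ₐ[F] C) (σ : L ≃ₐ[F] L) (z : Cˣ) (b : F) : Prop where
  semi : ∀ l, (z : C) * i l = i (σ l) * z
  pow : (z : C) ^ Module.finrank F L = algebraMap F C b
  ne_zero : b ≠ 0
  bij : Function.Bijective fun f : Fin (Module.finrank F L) → L =>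
    ∑ k, i (f k) * (z : C) ^ (k : ℕ)

lemma exists_isCyclicPresentation [FiniteDimensional F L] [Algebra.IsSeparable F L]
    [Algebra.IsCentral F C] [IsSimpleRing C]
    [FiniteDimensional F C] (i : L →ₐ[F] C) (σ : L ≃ₐ[F] L)
    (hσ : orderOf σ = Module.finrank F L) (hC : Module.finrank F C = Module.finrank F L ^ 2) :
    ∃ z b, IsCyclicPresentation i σ z b := by
  obtain ⟨z, hz⟩ := exists_unit_conj_eq i (σ : L →ₐ[F] L)
  replace hz : ∀ l, (z : C) * i l = i (σ l) * z := hz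
  have hbij := bijective_sum_mul_pow i σ hσ hC z hz
  have hmem : (z : C) ^ Module.finrank F L ∈ Subalgebra.center F C := by
    refine Subalgebra.mem_center_iff.mpr fun c => ?_
    obtain ⟨f, rfl⟩ := hbij.2 c
    refine (Commute.sum_left _ _ _ fun k _ => Commute.mul_left ?_ ?_)
    · refine (?_ : _ = _)
      rw [pow_mul_apply_of_semilinear hz, ← hσ, pow_orderOf_eq_one, AlgEquiv.one_apply]
    · exact Commute.pow_pow_self _ _ _
  obtain ⟨b, hb⟩ := (Algebra.IsCentral.mem_center_iff F).mp hmem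
  refine ⟨z, b, hz, hb, ?_, hbij⟩
  rintro rfl
  rw [map_zero, ← Units.val_pow_eq_pow_val] at hb
  exact Units.ne_zero _ hb

lemma IsCyclicPresentation.op [FiniteDimensional F L] [Algebra.IsSeparable F L]
    [Nontrivial C] [FiniteDimensional F C] {i : L →ₐ[F] C} {σ : L ≃ₐ[F] L}
    (hσ : orderOf σ = Module.finrank F L) (hC : Module.finrank F C = Module.finrank F L ^ 2)
    {z : Cˣ} {b : F} (h : IsCyclicPresentation i σ z b) :
    ∃ (i' : L →ₐ[F] Cᵐᵒᵖ) (z' : (Cᵐᵒᵖ)ˣ), IsCyclicPresentation i' σ z' b⁻¹ := by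
  let i' := i.toOpposite fun x y => (Commute.all x y).map i
  let z' : (Cᵐᵒᵖ)ˣ := Units.opEquiv.symm (MulOpposite.op z⁻¹)
  have hz' : (z' : Cᵐᵒᵖ) = MulOpposite.op ((z⁻¹ : Cˣ) : C) := rfl
  have hsemi : ∀ l, (z' : Cᵐᵒᵖ) * i' l = i' (σ l) * z' := fun l => by
    apply MulOpposite.unop_injective
    change i l * ((z⁻¹ : Cˣ) : C) = ((z⁻¹ : Cˣ) : C) * i (σ l)
    rw [Units.mul_inv_eq_iff_eq_mul, mul_assoc, ← h.semi, Units.inv_mul_cancel_left]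
  refine ⟨i', z', hsemi, ?_, inv_ne_zero h.ne_zero,
    bijective_sum_mul_pow i' σ hσ
      ((MulOpposite.opLinearEquiv F).finrank_eq.symm.trans hC) z' hsemi⟩
  rw [hz', ← MulOpposite.op_pow, MulOpposite.algebraMap_apply]
  congr 1
  rw [← Units.val_pow_eq_pow_val, inv_pow]
  apply Units.inv_eq_of_mul_eq_one_right
  rw [Units.val_pow_eq_pow_val, h.pow, ← map_mul, mul_inv_cancel₀ h.ne_zero, map_one]

lemma IsCyclicPresentation.exists_algHom {i : L →ₐ[F] C} {σ : L ≃ₐ[F] L} [FiniteDimensional F L]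
    {z : Cˣ} {b : F} (h : IsCyclicPresentation i σ z b) (j : L →ₐ[F] E) (Z : E)
    (hj : ∀ l, Z * j l = j (σ l) * Z) (hZ : Z ^ Module.finrank F L = algebraMap F E b) :
    ∃ Ψ : C →ₐ[F] E, ∀ c, Ψ c ∈ Submodule.span F (Set.range fun lk : L × ℕ => j lk.1 * Z ^ lk.2) := by
  have hN : 0 < Module.finrank F L := Module.finrank_pos
  let φ : (Fin (Module.finrank F L) → L) →ₗ[F] C :=
    { toFun := fun f => ∑ k, i (f k) * (z : C) ^ (k : ℕ)
      map_add' := fun f g => by simp [add_mul, Finset.sum_add_distrib]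
      map_smul' := fun r f => by simp [Finset.smul_sum] }
  let ψ : (Fin (Module.finrank F L) → L) →ₗ[F] E :=
    { toFun := fun f => ∑ k, j (f k) * Z ^ (k : ℕ)
      map_add' := fun f g => by simp [add_mul, Finset.sum_add_distrib]
      map_smul' := fun r f => by simp [Finset.smul_sum] }
  let Φ := LinearEquiv.ofBijective φ h.bij
  let Ψ : C →ₗ[F] E := ψ ∘ₗ Φ.symm.toLinearMap
  have hΨφ : ∀ f : Fin (Module.finrank F L) → L,
      Ψ (∑ k, i (f k) * (z : C) ^ (k : ℕ)) = ∑ k, j (f k) * Z ^ (k : ℕ) := fun f => by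
    change ψ (Φ.symm (Φ f)) = ψ f
    rw [LinearEquiv.symm_apply_apply]
  have hΨ : ∀ l n, Ψ (i l * (z : C) ^ n) = j l * Z ^ n := fun l n => by
    have key : ∀ {A : Type} [Ring A] [Algebra F A] (g : L →ₐ[F] A) (w : A),
        w ^ Module.finrank F L = algebraMap F A b →
        g l * w ^ n = ∑ k : Fin (Module.finrank F L),
          g ((Pi.single (⟨n % Module.finrank F L, Nat.mod_lt n hN⟩ : Fin (Module.finrank F L))
            (l * algebraMap F L (b ^ (n / Module.finrank F L))) : Fin _ → L) k) * w ^ (k : ℕ) := by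
      intro A _ _ g w hw
      rw [Finset.sum_eq_single ⟨n % Module.finrank F L, Nat.mod_lt n hN⟩
        (fun k _ hk => by rw [Pi.single_eq_of_ne hk, map_zero, zero_mul])
        (fun h => absurd (Finset.mem_univ _) h), Pi.single_eq_same, map_mul, AlgHom.commutes,
        map_pow, ← hw, mul_assoc, ← pow_mul, ← pow_add, Nat.div_add_mod]
    rw [key i z h.pow, key j Z hZ, hΨφ]
  have hspan : ∀ c, c ∈ Submodule.span F (Set.range fun lk : L × ℕ => i lk.1 * (z : C) ^ lk.2) :=
    fun c => by
      obtain ⟨f, rfl⟩ := h.bij.2 c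
      exact Submodule.sum_mem _ fun k _ => Submodule.subset_span ⟨(f k, k), rfl⟩
  have hmul : ∀ x y, Ψ (x * y) = Ψ x * Ψ y := fun x y => by
    induction hspan x using Submodule.span_induction with
    | zero => simp
    | add x x' _ _ hx hx' => rw [add_mul, map_add, hx, hx', map_add, add_mul]
    | smul r x _ hx => rw [smul_mul_assoc, map_smul, hx, map_smul, smul_mul_assoc]
    | mem x hx =>
      obtain ⟨⟨l, m⟩, rfl⟩ := hx
      induction hspan y using Submodule.span_induction with
      | zero => simp
      | add x x' _ _ hx hx' => rw [mul_add, map_add, hx, hx', map_add, mul_add]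
      | smul r x _ hx => rw [mul_smul_comm, map_smul, hx, map_smul, mul_smul_comm]
      | mem y hy =>
        obtain ⟨⟨l', n⟩, rfl⟩ := hy
        have key : ∀ {A : Type} [Ring A] [Algebra F A] (g : L →ₐ[F] A) (w : A),
            (∀ l, w * g l = g (σ l) * w) →
            g l * w ^ m * (g l' * w ^ n) = g (l * (σ ^ m) l') * w ^ (m + n) := by
          intro A _ _ g w hw
          rw [mul_assoc, ← mul_assoc (w ^ m), pow_mul_apply_of_semilinear hw, map_mul, pow_add]
          simp only [mul_assoc]
        simp only [hΨ]
        rw [key i z h.semi, key j Z hj, hΨ]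
  have hone : Ψ 1 = 1 := by simpa using hΨ 1 0
  refine ⟨AlgHom.ofLinearMap Ψ hone hmul, fun c => ?_⟩
  change Ψ c ∈ _
  induction hspan c using Submodule.span_induction with
  | zero => simp
  | add x x' _ _ hx hx' => rw [map_add]; exact Submodule.add_mem _ hx hx'
  | smul r x _ hx => rw [map_smul]; exact Submodule.smul_mem _ r hx
  | mem x hx =>
    obtain ⟨⟨l, m⟩, rfl⟩ := hx
    simp only [hΨ]
    exact Submodule.subset_span ⟨(l, m), rfl⟩

end CyclicData

section CyclicGalois
variable {F L : Type} [Field F] [Field L] [Algebra F L]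

lemma algebraMap_trace_eq_sum_pow [FiniteDimensional F L] [IsGalois F L] (σ : L ≃ₐ[F] L)
    (hσ : orderOf σ = Module.finrank F L) (x : L) :
    algebraMap F L (Algebra.trace F L x) = ∑ j ∈ Finset.range (Module.finrank F L), (σ ^ j) x := by
  classical
  have hinj : Set.InjOn (fun j : ℕ => σ ^ j) (Finset.range (Module.finrank F L) : Set ℕ) := by
    intro j hj k hk h
    rw [← hσ, Finset.coe_range] at hj hk
    exact pow_injOn_Iio_orderOf hj hk h
  have huniv : (Finset.range (Module.finrank F L)).image (fun j => σ ^ j) = Finset.univ := by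
    refine Finset.eq_univ_of_card _ ?_
    rw [Finset.card_image_of_injOn hinj, Finset.card_range, ← IsGalois.card_aut_eq_finrank,
      Nat.card_eq_fintype_card]
  rw [trace_eq_sum_automorphisms, ← huniv, Finset.sum_image hinj]

lemma exists_sum_mul_pow_apply_ne_zero (τ : L ≃ₐ[F] L) (hτ : 0 < orderOf τ) (c : ℕ → L)
    (hc : c 0 ≠ 0) : ∃ y, ∑ j ∈ Finset.range (orderOf τ), c j * (τ ^ j) y ≠ 0 := by
  by_contra! h
  have hinj : Function.Injective fun j : Fin (orderOf τ) =>
      (((τ ^ (j : ℕ) : L ≃ₐ[F] L) : L →* L)) := fun j k hjk => by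
    refine Fin.ext (pow_injOn_Iio_orderOf j.2 k.2 (AlgEquiv.ext fun x => ?_))
    exact DFunLike.congr_fun hjk x
  have hli := (linearIndependent_monoidHom L L).comp _ hinj
  refine hc (Fintype.linearIndependent_iff.mp hli (fun j => c j) ?_ ⟨0, hτ⟩)
  funext y
  have := h y
  rw [Finset.sum_range] at this
  simpa using this

lemma sum_range_pow_succ_apply (τ : L ≃ₐ[F] L) (c : ℕ → L) (hc : c (orderOf τ) = c 0) (y : L) :
    ∑ j ∈ Finset.range (orderOf τ), c (j + 1) * (τ ^ (j + 1)) y =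
      ∑ j ∈ Finset.range (orderOf τ), c j * (τ ^ j) y := by
  have h1 := Finset.sum_range_succ (fun j => c j * (τ ^ j) y) (orderOf τ)
  rw [Finset.sum_range_succ', hc, pow_orderOf_eq_one, pow_zero] at h1
  exact add_right_cancel h1

/-- Hilbert's theorem 90 for a cyclic group of automorphisms. -/
lemma exists_mul_apply_eq_self (τ : L ≃ₐ[F] L) (hτ : 0 < orderOf τ) (t : L)
    (ht : ∏ j ∈ Finset.range (orderOf τ), (τ ^ j) t = 1) : ∃ r ≠ 0, t * τ r = r := by
  let c : ℕ → L := fun j => ∏ k ∈ Finset.range j, (τ ^ k) t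
  have hc0 : c 0 = 1 := Finset.prod_range_zero _
  have hc : ∀ j, c (j + 1) = t * τ (c j) := fun j => by
    simp only [c]
    rw [Finset.prod_range_succ', map_prod, pow_zero, AlgEquiv.one_apply, mul_comm]
    simp only [pow_succ', AlgEquiv.mul_apply]
  obtain ⟨y, hy⟩ := exists_sum_mul_pow_apply_ne_zero τ hτ c (hc0 ▸ one_ne_zero)
  refine ⟨_, hy, ?_⟩
  rw [map_sum, Finset.mul_sum]
  refine Eq.trans (Finset.sum_congr rfl fun j _ => ?_)
    (sum_range_pow_succ_apply τ c (ht.trans hc0.symm) y)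
  rw [map_mul, hc, pow_succ', AlgEquiv.mul_apply, mul_assoc]

lemma exists_sum_pow_apply_eq_one (τ : L ≃ₐ[F] L) (hτ : 0 < orderOf τ) :
    ∃ y, ∑ j ∈ Finset.range (orderOf τ), (τ ^ j) y = 1 := by
  obtain ⟨y, hy⟩ := exists_sum_mul_pow_apply_ne_zero τ hτ (fun _ => 1) one_ne_zero
  have hs := sum_range_pow_succ_apply τ (fun _ => 1) rfl y
  simp only [one_mul] at hy hs
  have hfix : ∀ j : ℕ, (τ ^ j) (∑ j ∈ Finset.range (orderOf τ), (τ ^ j) y) =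
      ∑ j ∈ Finset.range (orderOf τ), (τ ^ j) y := fun j => by
    induction j with
    | zero => rw [pow_zero, AlgEquiv.one_apply]
    | succ j ih =>
      rw [pow_succ', AlgEquiv.mul_apply, ih, map_sum]
      conv_rhs => rw [← hs]
      simp only [pow_succ', AlgEquiv.mul_apply]
  refine ⟨y / ∑ j ∈ Finset.range (orderOf τ), (τ ^ j) y, ?_⟩
  rw [Finset.sum_congr rfl fun j _ => by rw [map_div₀, hfix], ← Finset.sum_div, div_self hy]

/-- Artin–Schreier generators. -/
lemma exists_apply_eq_add_one (p : ℕ) [CharP L p] (hp : 0 < p) (τ : L ≃ₐ[F] L)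
    (hτ : orderOf τ = p) : ∃ θ, τ θ = θ + 1 := by
  obtain ⟨y, hy⟩ := exists_sum_pow_apply_eq_one τ (hτ ▸ hp)
  have h1 := sum_range_pow_succ_apply τ (fun _ => 1) rfl y
  have h2 := sum_range_pow_succ_apply τ (fun j => (j : L)) (by simp [hτ]) y
  refine ⟨-∑ j ∈ Finset.range (orderOf τ), (j : L) * (τ ^ j) y, ?_⟩
  simp only [one_mul] at h1
  simp only [Nat.cast_add, Nat.cast_one, add_mul, one_mul, Finset.sum_add_distrib] at h2
  rw [h1, hy] at h2
  have h3 : ∑ j ∈ Finset.range (orderOf τ), (j : L) * (τ ^ (j + 1)) y =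
      τ (∑ j ∈ Finset.range (orderOf τ), (j : L) * (τ ^ j) y) := by
    rw [map_sum]
    exact Finset.sum_congr rfl fun j _ => by
      rw [map_mul, map_natCast, pow_succ', AlgEquiv.mul_apply]
  rw [map_neg, ← h3, ← h2]
  ring

@[to_additive sum_range_mul_eq_sum_sum]
lemma prod_range_mul_eq_prod_prod {M : Type} [CommMonoid M] (f : ℕ → M) (m n : ℕ) :
    ∏ j ∈ Finset.range (m * n), f j =
      ∏ k ∈ Finset.range m, ∏ j ∈ Finset.range n, f (k + m * j) := by
  induction n with
  | zero => simp
  | succ n ih =>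
    rw [Nat.mul_succ, Finset.prod_range_add, ih, ← Finset.prod_mul_distrib]
    refine Finset.prod_congr rfl fun k _ => ?_
    rw [Finset.prod_range_succ, Nat.add_comm k]

lemma exists_prod_pow_apply_eq {p : ℕ} (hp : 0 < p) (σ : L ≃ₐ[F] L)
    (hσ : orderOf (σ ^ p) = p) (l : L) (b : F) (hb : b ≠ 0)
    (h : ∏ j ∈ Finset.range (p * p), (σ ^ j) l = algebraMap F L (b ^ p)) :
    ∃ x, (σ ^ p) x = x ∧ ∏ k ∈ Finset.range p, (σ ^ k) x = algebraMap F L b := by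
  have hb' : algebraMap F L b ≠ 0 := by simpa using hb
  have hpos : ∀ (k : ℕ) {r : L}, r ≠ 0 → (σ ^ k) r ≠ 0 := fun k r hr =>
    (map_ne_zero_iff _ (σ ^ k).injective).mpr hr
  have ht : ∏ j ∈ Finset.range (orderOf (σ ^ p)),
      ((σ ^ p) ^ j) ((∏ k ∈ Finset.range p, (σ ^ k) l) / algebraMap F L b) = 1 := by
    have h1 : ∏ j ∈ Finset.range p, ((σ ^ p) ^ j) (∏ k ∈ Finset.range p, (σ ^ k) l) =
        algebraMap F L (b ^ p) := by
      rw [← h, prod_range_mul_eq_prod_prod, Finset.prod_comm]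
      refine Finset.prod_congr rfl fun j _ => ?_
      rw [map_prod]
      refine Finset.prod_congr rfl fun k _ => ?_
      rw [← AlgEquiv.mul_apply, ← pow_mul, ← pow_add, Nat.add_comm]
    rw [hσ, Finset.prod_congr rfl fun j _ => by rw [map_div₀, AlgEquiv.commutes],
      Finset.prod_div_distrib, h1, Finset.prod_const, Finset.card_range, map_pow,
      div_self (pow_ne_zero _ hb')]
  obtain ⟨r, hr0, hr⟩ := exists_mul_apply_eq_self (σ ^ p) (hσ.symm ▸ hp) _ ht
  have hprod : ∏ k ∈ Finset.range p, (σ ^ k) (l * σ r / r) = algebraMap F L b := by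
    have htel : ∀ n : ℕ, ∏ k ∈ Finset.range n, (σ ^ k) (l * σ r / r) =
        (∏ k ∈ Finset.range n, (σ ^ k) l) * (σ ^ n) r / r := fun n => by
      induction n with
      | zero =>
        rw [Finset.prod_range_zero, Finset.prod_range_zero, pow_zero, AlgEquiv.one_apply, one_mul,
          div_self hr0]
      | succ n ih =>
        have := hpos n hr0
        rw [Finset.prod_range_succ, ih, Finset.prod_range_succ, map_div₀, map_mul, pow_succ σ,
          AlgEquiv.mul_apply]
        field_simp
    rw [htel, div_eq_iff hr0]
    rw [div_mul_eq_mul_div, div_eq_iff hb'] at hr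
    rw [hr, mul_comm]
  refine ⟨l * σ r / r, ?_, hprod⟩
  have h1 := Finset.prod_range_succ (fun k => (σ ^ k) (l * σ r / r)) p
  rw [Finset.prod_range_succ', hprod] at h1
  have h2 : ∏ k ∈ Finset.range p, (σ ^ (k + 1)) (l * σ r / r) = algebraMap F L b := by
    rw [Finset.prod_congr rfl fun k _ => by rw [pow_succ' σ, AlgEquiv.mul_apply], ← map_prod,
      hprod, AlgEquiv.commutes]
  rw [h2, pow_zero, AlgEquiv.one_apply] at h1
  exact (mul_left_cancel₀ hb' h1).symm

lemma exists_dual_families [FiniteDimensional F L] [IsGalois F L] {p : ℕ} (hp : 0 < p)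
    (σ : L ≃ₐ[F] L) (hσ : orderOf σ = Module.finrank F L) (hL : Module.finrank F L = p * p) :
    ∃ e f : Fin p → L, (∀ j, (σ ^ p) (e j) = e j) ∧ (∀ j, (σ ^ p) (f j) = f j) ∧
      ∀ j m, ∑ k ∈ Finset.range p, (σ ^ k) (e j * f m) = if j = m then 1 else 0 := by
  classical
  have hτ : orderOf (σ ^ p) = p := by
    rw [orderOf_pow_of_dvd hp.ne' (hσ.trans hL ▸ dvd_mul_right p p), hσ, hL,
      Nat.mul_div_cancel _ hp]
  let M := IntermediateField.fixedField (Subgroup.zpowers (σ ^ p))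
  have hM : ∀ {x : L}, x ∈ M ↔ (σ ^ p) x = x := fun {x} => by
    rw [IntermediateField.mem_fixedField_iff]
    refine ⟨fun h => h _ (Subgroup.mem_zpowers _), fun h f hf => ?_⟩
    have : Subgroup.zpowers (σ ^ p) ≤ MulAction.stabilizer (L ≃ₐ[F] L) x :=
      (Subgroup.zpowers_le).mpr h
    exact this hf
  have hMrank : Module.finrank F M = p := by
    have h1 := Module.finrank_mul_finrank F M L
    rw [IntermediateField.finrank_fixedField_eq_card, Nat.card_zpowers, hτ, hL] at h1
    exact Nat.eq_of_mul_eq_mul_right hp h1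
  have htr : ∀ x : L, algebraMap F L (Algebra.trace F L x) =
      ∑ k ∈ Finset.range p, (σ ^ k) (∑ j ∈ Finset.range p, ((σ ^ p) ^ j) x) := fun x => by
    rw [algebraMap_trace_eq_sum_pow σ hσ, hL, sum_range_mul_eq_sum_sum]
    refine Finset.sum_congr rfl fun k _ => ?_
    rw [map_sum]
    refine Finset.sum_congr rfl fun j _ => ?_
    rw [← AlgEquiv.mul_apply, ← pow_mul, ← pow_add]
  have hfix : ∀ x ∈ M, ∀ j : ℕ, ((σ ^ p) ^ j) x = x := fun x hx j => by
    induction j with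
    | zero => rw [pow_zero, AlgEquiv.one_apply]
    | succ j ih => rw [pow_succ, AlgEquiv.mul_apply, hM.mp hx, ih]
  obtain ⟨y, hy⟩ := exists_sum_pow_apply_eq_one (σ ^ p) (hτ.symm ▸ hp)
  rw [hτ] at hy
  let B : LinearMap.BilinForm F M := LinearMap.mk₂ F (fun m n => Algebra.trace F L (m * n * y))
    (fun _ _ _ => by simp [add_mul]) (fun _ _ _ => by simp)
    (fun _ _ _ => by simp [mul_add, add_mul]) (fun _ _ _ => by simp)
  have hBdef : ∀ m n : M, algebraMap F L (B m n) =
      ∑ k ∈ Finset.range p, (σ ^ k) ((m : L) * n) := fun m n => by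
    refine (htr _).trans (Finset.sum_congr rfl fun k _ => ?_)
    rw [Finset.sum_congr rfl fun j _ => by
      rw [map_mul, hfix _ (M.mul_mem m.2 n.2)], ← Finset.mul_sum, hy, mul_one]
  have hsymm : B.IsSymm := ⟨fun m n => by
    apply FaithfulSMul.algebraMap_injective F L
    rw [hBdef, hBdef, mul_comm]⟩
  have hBnd : B.Nondegenerate := by
    refine LinearMap.BilinForm.Nondegenerate.ofSeparatingLeft fun m hm => ?_
    by_contra hm0
    refine Algebra.trace_ne_zero F L (LinearMap.ext fun w => ?_)
    apply FaithfulSMul.algebraMap_injective F L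
    have hs : ∑ j ∈ Finset.range p, ((σ ^ p) ^ j) w ∈ M := hM.mpr (by
      have hs := sum_range_pow_succ_apply (σ ^ p) (fun _ => 1) rfl w
      simp only [one_mul, hτ] at hs
      rw [map_sum]
      conv_rhs => rw [← hs]
      simp only [pow_succ', AlgEquiv.mul_apply])
    have := hBdef m (⟨_, hs⟩ / m)
    rw [hm, ← MulMemClass.coe_mul, mul_div_cancel₀ _ hm0] at this
    rw [htr, LinearMap.zero_apply, this]
  let e := Module.finBasisOfFinrankEq F M hMrank
  refine ⟨fun j => e j, fun j => B.dualBasis hBnd e j, fun j => hM.mp (e j).2,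
    fun j => hM.mp (B.dualBasis hBnd e j).2, fun j m => ?_⟩
  rw [← hBdef, LinearMap.BilinForm.apply_dualBasis_right hBnd hsymm]
  split_ifs <;> simp

end CyclicGalois

section NormCondition
variable {F C L U : Type} [Field F] [Ring C] [Algebra F C] [Field L] [Algebra F L]
  [AddCommGroup U] [Module F U]

/-- Two commuting actions of a cyclic extension agree, up to a twist, on some nonzero vector. -/
lemma exists_ne_zero_twisted_eq [FiniteDimensional F L] [IsGalois F L] (σ : L ≃ₐ[F] L)
    (hσ : orderOf σ = Module.finrank F L) (R S : L →ₐ[F] Module.End F U)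
    (hRS : ∀ l m, Commute (R l) (S m)) {W : Submodule F U} (hW : W ≠ ⊥)
    (hRW : ∀ l, ∀ w ∈ W, R l w ∈ W) (hSW : ∀ l, ∀ w ∈ W, S l w ∈ W) :
    ∃ w ∈ W, w ≠ 0 ∧ ∃ k : ℕ, ∀ l, R l w = S ((σ ^ k) l) w := by
  classical
  obtain ⟨w, hw, hw0⟩ := Submodule.exists_mem_ne_zero_of_ne_bot hW
  let e := Module.finBasis F L
  let f := e.traceDual
  have hf : ∀ x, x = ∑ i, Algebra.trace F L (x * e i) • f i := fun x => by
    conv_lhs => rw [← f.sum_repr x]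
    simp only [f, Module.Basis.traceDual_repr_apply, Algebra.traceForm_apply]
  have he : ∀ x, x = ∑ i, Algebra.trace F L (x * f i) • e i := fun x => by
    have h := f.traceDual.sum_repr x
    simp only [Module.Basis.traceDual_repr_apply, Algebra.traceForm_apply] at h
    rw [Module.Basis.traceDual_traceDual] at h
    exact h.symm
  let P : ℕ → Module.End F U := fun k => ∑ j, S ((σ ^ k) (e j)) * R (f j)
  have hP : ∀ k l, R l * P k = S ((σ ^ k) l) * P k := fun k l => by
    have h1 : R l * P k = ∑ j, ∑ i, Algebra.trace F L (l * f j * e i) •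
        (S ((σ ^ k) (e j)) * R (f i)) := by
      simp only [P, Finset.mul_sum]
      refine Finset.sum_congr rfl fun j _ => ?_
      rw [← mul_assoc, (hRS _ _).eq, mul_assoc, ← map_mul, hf (l * f j), map_sum, Finset.mul_sum]
      simp only [map_smul, mul_smul_comm]
      rw [← hf]
    have h2 : S ((σ ^ k) l) * P k = ∑ i, ∑ j, Algebra.trace F L (l * e i * f j) •
        (S ((σ ^ k) (e j)) * R (f i)) := by
      simp only [P, Finset.mul_sum]
      refine Finset.sum_congr rfl fun i _ => ?_
      rw [← mul_assoc, ← map_mul, ← map_mul, he (l * e i), map_sum, map_sum, Finset.sum_mul]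
      simp only [map_smul, smul_mul_assoc]
      rw [← he]
    rw [h1, h2, Finset.sum_comm]
    refine Finset.sum_congr rfl fun i _ => Finset.sum_congr rfl fun j _ => ?_
    rw [mul_right_comm]
  have hsum : ∑ k ∈ Finset.range (Module.finrank F L), P k = 1 := by
    simp only [P]
    rw [Finset.sum_comm]
    simp only [← Finset.sum_mul, ← map_sum, ← algebraMap_trace_eq_sum_pow σ hσ]
    have := congrArg R (hf 1)
    rw [map_one] at this
    rw [this, map_sum]
    refine Finset.sum_congr rfl fun i _ => ?_
    rw [AlgHom.commutes, one_mul, map_smul, Algebra.smul_def]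
  obtain ⟨k, hk⟩ : ∃ k, P k w ≠ 0 := by
    by_contra! h
    apply hw0
    have := LinearMap.congr_fun hsum w
    rw [LinearMap.sum_apply, Finset.sum_eq_zero fun k _ => h k] at this
    exact this.symm
  refine ⟨P k w, ?_, hk, k, fun l => LinearMap.congr_fun (hP k l) w⟩
  simp only [P, LinearMap.sum_apply]
  exact Submodule.sum_mem _ fun j _ => hSW _ _ (hRW _ _ hw)

lemma finrank_mul_finrank_le_of_twist [FiniteDimensional F L] [Algebra.IsSeparable F L]
    [FiniteDimensional F U] (σ : L ≃ₐ[F] L)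
    (hσ : orderOf σ = Module.finrank F L) (R S : L →ₐ[F] Module.End F U)
    (hRS : ∀ l m, Commute (R l) (S m)) (y : Module.End F U) (hy : Function.Injective y)
    (hyR : ∀ l, Commute y (R l)) (hyS : ∀ l, y * S l = S (σ l) * y) {W W' : Submodule F U}
    (hyW : ∀ w ∈ W, y w ∈ W) (hW' : W' ≤ W) (h : ∀ w ∈ W', ∀ l, R l w = S l w) :
    Module.finrank F L * Module.finrank F W' ≤ Module.finrank F W := by
  have hyk : ∀ k : ℕ, ∀ w ∈ W, (y ^ k) w ∈ W := by
    intro k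
    induction k with
    | zero => exact fun w hw => hw
    | succ k ih =>
      intro w hw
      rw [pow_succ, Module.End.mul_apply]
      exact ih _ (hyW _ hw)
  let φ : (Fin (Module.finrank F L) → W') →ₗ[F] W :=
    { toFun := fun w => ⟨∑ k : Fin (Module.finrank F L), (y ^ (k : ℕ)) (w k),
        Submodule.sum_mem _ fun k _ => hyk _ _ (hW' (w k).2)⟩
      map_add' := fun v w => Subtype.ext (by simp [Finset.sum_add_distrib])
      map_smul' := fun r w => Subtype.ext (by simp [Finset.smul_sum]) }
  have hφ : Function.Injective φ := by
    rw [← LinearMap.ker_eq_bot, LinearMap.ker_eq_bot']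
    intro w hw
    obtain ⟨a, ha⟩ := exists_pow_apply_injective σ
    rw [hσ] at ha
    let _ : Module L U := Module.compHom U (S : L →+* Module.End F U)
    have hsmul : ∀ (l : L) (u : U), l • u = S l u := fun _ _ => rfl
    let E : Module.End L U :=
      { toFun := R a
        map_add' := map_add _
        map_smul' := fun l u => LinearMap.congr_fun (hRS a l).eq u }
    have hind := (iSupIndep_iff_finsetSum_eq_zero_imp_eq_zero _).mp
      ((Module.End.eigenspaces_iSupIndep E).comp ha) Finset.univ
      (fun k => (y ^ (k : ℕ)) (w k)) (fun k _ => by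
        rw [Function.comp_apply, Module.End.mem_eigenspace_iff, hsmul]
        change (R a * y ^ (k : ℕ)) (w k) = (S ((σ ^ (k : ℕ)) a) * y ^ (k : ℕ)) (w k)
        rw [← ((hyR a).pow_left k).eq, ← pow_mul_apply_of_semilinear (i := S) hyS,
          Module.End.mul_apply, Module.End.mul_apply, h _ (w k).2])
      (congrArg Subtype.val hw)
    funext k
    refine Subtype.ext ?_
    have hk := hind k (Finset.mem_univ k)
    rw [Module.End.pow_apply] at hk
    exact hy.iterate k (hk.trans (by rw [← Module.End.pow_apply]; exact (map_zero _).symm))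
  have := LinearMap.finrank_le_finrank_of_injective hφ
  rwa [Module.finrank_pi_fintype, Finset.sum_const, Finset.card_univ, Fintype.card_fin,
    smul_eq_mul] at this

end NormCondition

section NormCondition
variable {F C L U : Type} [Field F] [Ring C] [Algebra F C] [Field L] [Algebra F L]
  [AddCommGroup U] [Module F U]

/-- Cutting down a module over a tensor power of a cyclic algebra to the part on which the copies
of the maximal subfield in the factors `0, …, n` act in the same way. -/
lemma IsCyclicPresentation.exists_submodule [FiniteDimensional F L] [IsGalois F L]
    [FiniteDimensional F U] [Nontrivial U] {i : L →ₐ[F] C} {σ : L ≃ₐ[F] L}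
    (hσ : orderOf σ = Module.finrank F L) {z : Cˣ} {b : F} (h : IsCyclicPresentation i σ z b)
    {p : ℕ} (ρ : ℕ → C →ₐ[F] Module.End F U)
    (hρ : ∀ j < p, ∀ k < p, j ≠ k → ∀ c d, Commute (ρ j c) (ρ k d)) (n : ℕ) (hn : n < p) :
    ∃ (W : Submodule F U) (ζ : Module.End F U), W ≠ ⊥ ∧
      Module.finrank F L ^ n * Module.finrank F W ≤ Module.finrank F U ∧
      (∀ l, ∀ w ∈ W, ρ 0 (i l) w ∈ W) ∧ (∀ w ∈ W, ζ w ∈ W) ∧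
      (∀ l, ζ * ρ 0 (i l) = ρ 0 (i (σ l)) * ζ) ∧
      ζ ^ Module.finrank F L = algebraMap F _ (b ^ (n + 1)) ∧
      ∀ k < p, n < k → ∀ c, Commute ζ (ρ k c) ∧ ∀ w ∈ W, ρ k c w ∈ W := by
  induction n with
  | zero =>
    refine ⟨⊤, ρ 0 z, top_ne_bot, ?_, fun _ _ _ => trivial, fun _ _ => trivial, fun l => ?_, ?_,
      fun k hk hk0 c => ⟨hρ _ hn _ hk hk0.ne _ _, fun _ _ => trivial⟩⟩
    · rw [pow_zero, one_mul, finrank_top]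
    · rw [← map_mul, h.semi, map_mul]
    · rw [← map_pow, h.pow, AlgHom.commutes, zero_add, pow_one]
  | succ n ih =>
    obtain ⟨W, ζ, hW, hdim, hRW, hζW, hζR, hζ, hk⟩ := ih (Nat.lt_of_succ_lt hn)
    let R := (ρ 0).comp i
    let S := (ρ (n + 1)).comp i
    let y := ρ (n + 1) z
    have hR : ∀ l, R l = ρ 0 (i l) := fun _ => rfl
    have hS : ∀ l, S l = ρ (n + 1) (i l) := fun _ => rfl
    have h0 : ∀ c d, Commute (ρ 0 c) (ρ (n + 1) d) :=
      hρ 0 (Nat.zero_lt_of_lt hn) _ hn (Nat.succ_ne_zero n).symm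
    have hRR : ∀ l m, Commute (R l) (R m) := fun l m => (Commute.all l m).map R
    have hRS : ∀ l m, Commute (R l) (S m) := fun l m => h0 _ _
    have hyR : ∀ l, Commute y (R l) := fun l => (h0 _ _).symm
    have hyS : ∀ l, y * S l = S (σ l) * y := fun l => by
      rw [hS, hS, ← map_mul, h.semi, map_mul]
    have hζS : ∀ l, Commute ζ (S l) := fun l => (hk _ hn n.lt_succ_self _).1
    have hζy : Commute ζ y := (hk _ hn n.lt_succ_self _).1
    have hSW : ∀ l, ∀ w ∈ W, S l w ∈ W := fun l => (hk _ hn n.lt_succ_self _).2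
    have hyW : ∀ w ∈ W, y w ∈ W := (hk _ hn n.lt_succ_self _).2
    have hyinj : Function.Injective y :=
      ((Module.End.isUnit_iff y).mp (z.isUnit.map (ρ (n + 1)))).1
    let W' : Submodule F U := W ⊓ ⨅ l, LinearMap.ker (R l - S l)
    have hW'mem : ∀ {w}, w ∈ W' ↔ w ∈ W ∧ ∀ l, R l w = S l w := fun {w} => by
      simp [W', sub_eq_zero]
    have hcomm : ∀ T : Module.End F U, (∀ l, Commute T (R l)) → (∀ l, Commute T (S l)) →
        (∀ w ∈ W, T w ∈ W) → ∀ w ∈ W', T w ∈ W' := fun T hTR hTS hTW w hw => by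
      obtain ⟨hw1, hw2⟩ := hW'mem.mp hw
      refine hW'mem.mpr ⟨hTW w hw1, fun l => ?_⟩
      rw [← Module.End.mul_apply, ← Module.End.mul_apply, ← (hTR l).eq, ← (hTS l).eq,
        Module.End.mul_apply, Module.End.mul_apply, hw2]
    refine ⟨W', ζ * y, ?_, ?_, fun l => ?_, fun w hw => ?_, fun l => ?_, ?_,
      fun k hkp hnk c => ⟨?_, ?_⟩⟩
    · obtain ⟨w, hw, hw0, k, hwk⟩ := exists_ne_zero_twisted_eq σ hσ R S hRS hW hRW hSW
      obtain ⟨m, hm⟩ : ∃ m : ℕ, σ ^ m * σ ^ k = 1 := by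
        refine ⟨k * (orderOf σ - 1), ?_⟩
        have hpos : 0 < orderOf σ := hσ ▸ Module.finrank_pos
        rw [← pow_add, ← Nat.mul_succ, Nat.succ_eq_add_one, Nat.sub_add_cancel hpos, mul_comm,
          pow_mul, pow_orderOf_eq_one, one_pow]
      have hymW : ∀ m : ℕ, (y ^ m) w ∈ W := fun m => by
        induction m with
        | zero => exact hw
        | succ m ih => rw [pow_succ', Module.End.mul_apply]; exact hyW _ ih
      refine Submodule.ne_bot_iff _ |>.mpr ⟨(y ^ m) w, hW'mem.mpr ⟨hymW m, fun l => ?_⟩, ?_⟩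
      · rw [← Module.End.mul_apply, ← ((hyR l).pow_left m).eq, Module.End.mul_apply, hwk,
          ← Module.End.mul_apply, pow_mul_apply_of_semilinear (i := S) hyS, ← AlgEquiv.mul_apply,
          hm, AlgEquiv.one_apply, Module.End.mul_apply]
      · rw [Module.End.pow_apply]
        intro h0
        exact hw0 (hyinj.iterate m (h0.trans (by rw [← Module.End.pow_apply, map_zero])))
    · have := finrank_mul_finrank_le_of_twist σ hσ R S hRS y hyinj hyR hyS hyW
        (inf_le_left : W' ≤ W) fun w hw => (hW'mem.mp hw).2
      rw [pow_succ, mul_assoc]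
      exact (Nat.mul_le_mul_left _ this).trans hdim
    · exact hcomm (R l) (hRR l) (hRS l) (hRW l)
    · obtain ⟨hw1, hw2⟩ := hW'mem.mp hw
      refine hW'mem.mpr ⟨hζW _ (hyW _ hw1), fun l => ?_⟩
      obtain ⟨l, rfl⟩ := σ.surjective l
      have h1 : R (σ l) * (ζ * y) = ζ * y * R l := by
        rw [← mul_assoc, hR, ← hζR, mul_assoc, mul_assoc, (hyR l).eq, hR]
      have h2 : S (σ l) * (ζ * y) = ζ * y * S l := by
        rw [← mul_assoc, ← (hζS _).eq, mul_assoc, mul_assoc, hyS]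
      rw [← Module.End.mul_apply, ← Module.End.mul_apply, h1, h2, Module.End.mul_apply,
        Module.End.mul_apply (ζ * y), hw2]
    · rw [← hR l, mul_assoc, (hyR l).eq, hR, ← mul_assoc, hζR, mul_assoc]
    · rw [hζy.mul_pow, hζ, ← map_pow, h.pow, AlgHom.commutes, ← map_mul, ← pow_succ]
    · exact ((hk _ hkp (Nat.lt_of_succ_lt hnk) _).1).mul_left (hρ _ hn _ hkp hnk.ne _ _)
    · refine hcomm _ (fun l => hρ _ hkp _ (Nat.zero_lt_of_lt hn) (Nat.ne_zero_of_lt hnk) _ _)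
        (fun l => hρ _ hkp _ hn hnk.ne' _ _) (hk _ hkp (Nat.lt_of_succ_lt hnk) _).2

lemma IsCyclicPresentation.exists_norm_eq [FiniteDimensional F L] [IsGalois F L]
    [FiniteDimensional F U] [Nontrivial U] {i : L →ₐ[F] C} {σ : L ≃ₐ[F] L}
    (hσ : orderOf σ = Module.finrank F L) {z : Cˣ} {b : F} (h : IsCyclicPresentation i σ z b)
    {p : ℕ} (hp : 0 < p) (ρ : ℕ → C →ₐ[F] Module.End F U)
    (hρ : ∀ j < p, ∀ k < p, j ≠ k → ∀ c d, Commute (ρ j c) (ρ k d))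
    (hU : Module.finrank F U = Module.finrank F L ^ p) :
    ∃ l : L, ∏ j ∈ Finset.range (Module.finrank F L), (σ ^ j) l = algebraMap F L (b ^ p) := by
  obtain ⟨W, ζ, hW, hdim, hRW, hζW, hζR, hζ, -⟩ :=
    h.exists_submodule hσ ρ hρ (p - 1) (Nat.sub_lt hp one_pos)
  rw [Nat.sub_one_add_one hp.ne'] at hζ
  obtain ⟨w, hw, hw0⟩ := Submodule.exists_mem_ne_zero_of_ne_bot hW
  let R := (ρ 0).comp i
  have hR : ∀ l, R l = ρ 0 (i l) := fun _ => rfl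
  have hRinj : ∀ l m, R l w = R m w → l = m := fun l m hlm => by
    by_contra hne
    refine hw0 ?_
    have h1 : R (l - m) w = 0 := by rw [map_sub, LinearMap.sub_apply, hlm, sub_self]
    have h2 : R ((l - m)⁻¹ * (l - m)) w = 0 := by rw [map_mul, Module.End.mul_apply, h1, map_zero]
    rwa [inv_mul_cancel₀ (sub_ne_zero.mpr hne), map_one] at h2
  let φ : L →ₗ[F] W :=
    { toFun := fun l => ⟨R l w, hRW l w hw⟩
      map_add' := fun l m => Subtype.ext (by simp)
      map_smul' := fun r l => Subtype.ext (by simp) }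
  have hφ : Function.Injective φ := fun l m hlm => hRinj l m (congrArg Subtype.val hlm)
  have hWdim : Module.finrank F L = Module.finrank F W := by
    refine le_antisymm (LinearMap.finrank_le_finrank_of_injective hφ) ?_
    refine Nat.le_of_mul_le_mul_left ?_ (pow_pos (Module.finrank_pos (R := F) (M := L)) (p - 1))
    rwa [← pow_succ, Nat.sub_one_add_one hp.ne', ← hU]
  obtain ⟨l, hl⟩ := (LinearMap.injective_iff_surjective_of_finrank_eq_finrank hWdim).mp hφ
    ⟨ζ w, hζW w hw⟩
  replace hl : R l w = ζ w := congrArg Subtype.val hl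
  refine ⟨l, hRinj _ _ ?_⟩
  have hpow : ∀ n : ℕ, (ζ ^ n) w = R (∏ j ∈ Finset.range n, (σ ^ j) l) w := fun n => by
    induction n with
    | zero => simp
    | succ n ih =>
      rw [pow_succ', Module.End.mul_apply, ih, hR, ← Module.End.mul_apply, hζR,
        Module.End.mul_apply, ← hl, hR, ← Module.End.mul_apply, ← map_mul, ← map_mul,
        Finset.prod_range_succ', map_prod, pow_zero, AlgEquiv.one_apply, hR]
      simp only [pow_succ', AlgEquiv.mul_apply]
  rw [← hpow, hζ, AlgHom.commutes]

lemma IsCyclicPresentation.exists_norm_eq_of_isSplitAlg [FiniteDimensional F L] [IsGalois F L]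
    [FiniteDimensional F C] {i : L →ₐ[F] C} {σ : L ≃ₐ[F] L}
    (hσ : orderOf σ = Module.finrank F L) (hC : Module.finrank F C = Module.finrank F L ^ 2)
    {z : Cˣ} {b : F} (h : IsCyclicPresentation i σ z b)
    {p : ℕ} (hp : 0 < p) (hsplit : IsSplitAlg F (⨂[F] _ : Fin p, C)) :
    ∃ l : L, ∏ j ∈ Finset.range (Module.finrank F L), (σ ^ j) l = algebraMap F L (b ^ p) := by
  classical
  obtain ⟨m, hm, ⟨e⟩⟩ := hsplit
  have : NeZero p := ⟨hp.ne'⟩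
  have : NeZero m := ⟨hm.ne'⟩
  have hdim : m = Module.finrank F L ^ p := by
    have h1 := e.toLinearEquiv.finrank_eq
    rw [Module.finrank_eq_card_basis
      (Basis.piTensorProduct fun _ : Fin p => Module.finBasis F C), Module.finrank_matrix] at h1
    simp only [Fintype.card_pi, Fintype.card_fin, Finset.prod_const, Finset.card_univ, hC,
      Module.finrank_self, mul_one] at h1
    rw [← pow_mul, mul_comm 2, pow_mul, ← sq] at h1
    exact (Nat.pow_left_injective two_ne_zero h1).symm
  let Φ : (⨂[F] _ : Fin p, C) →ₐ[F] Module.End F (Fin m → F) :=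
    (Matrix.toLinAlgEquiv' : _ ≃ₐ[F] _).toAlgHom.comp e.toAlgHom
  refine h.exists_norm_eq (U := Fin m → F) hσ hp
    (fun k => Φ.comp (PiTensorProduct.singleAlgHom (A := fun _ => C) (Fin.ofNat p k)))
    (fun j hj k hk hjk c d => ?_) (by simpa using hdim)
  have hne : Fin.ofNat p j ≠ Fin.ofNat p k := fun hjk' => hjk (by
    simpa [Nat.mod_eq_of_lt hj, Nat.mod_eq_of_lt hk] using congrArg Fin.val hjk')
  exact ((Pi.mulSingle_commute (f := fun _ => C) hne c d).map
    (PiTensorProduct.tprodMonoidHom F)).map Φ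

end NormCondition

section TwistedWeyl
variable {F L E : Type} [Field F] [Field L] [Algebra F L] [Ring E] [Algebra F E]

lemma pow_mod_apply_of_pow_apply_eq {p : ℕ} {σ : L ≃ₐ[F] L} {m : L} (h : (σ ^ p) m = m) (n : ℕ) :
    (σ ^ (n % p)) m = (σ ^ n) m := by
  have hq : ∀ q : ℕ, ((σ ^ p) ^ q) m = m := fun q => by
    induction q with
    | zero => rw [pow_zero, AlgEquiv.one_apply]
    | succ q ih => rw [pow_succ, AlgEquiv.mul_apply, h, ih]
  conv_rhs => rw [← Nat.mod_add_div n p, pow_add, pow_mul, AlgEquiv.mul_apply, hq]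

lemma pow_val_add_one_apply {p : ℕ} [NeZero p] {σ : L ≃ₐ[F] L} {m : L} (h : (σ ^ p) m = m)
    (k : ZMod p) : (σ ^ (k + 1).val) m = σ ((σ ^ k.val) m) := by
  rw [ZMod.val_add, ZMod.val_one_eq_one_mod, Nat.add_mod_mod, pow_mod_apply_of_pow_apply_eq h,
    pow_succ', AlgEquiv.mul_apply]

lemma sum_zmod_val {M : Type} [AddCommMonoid M] {p : ℕ} [NeZero p] (g : ℕ → M) :
    ∑ k : ZMod p, g k.val = ∑ k ∈ Finset.range p, g k := by
  obtain ⟨n, rfl⟩ := Nat.exists_eq_succ_of_ne_zero (NeZero.ne p)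
  exact (Finset.sum_range g).symm

/-- Averaging a family of Weyl pairs permuted by `Z` over a trace form produces a Weyl family
commuting with `Z`. -/
lemma exists_isWeylFamily_of_twisted {p : ℕ} [NeZero p] (σ : L ≃ₐ[F] L) {e f : Fin p → L}
    (he : ∀ j, (σ ^ p) (e j) = e j) (hf : ∀ j, (σ ^ p) (f j) = f j)
    (hef : ∀ j m, ∑ k ∈ Finset.range p, (σ ^ k) (e j * f m) = if j = m then 1 else 0)
    (ι : L →ₐ[F] E) (Z : E) (G J : ZMod p → E)
    (hZ : ∀ l, Z * ι l = ι (σ l) * Z) (hZG : ∀ k, Z * G k = G (k + 1) * Z)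
    (hZJ : ∀ k, Z * J k = J (k + 1) * Z) (hιG : ∀ l k, Commute (ι l) (G k))
    (hιJ : ∀ l k, Commute (ι l) (J k)) (hGG : ∀ k l, Commute (G k) (G l))
    (hJJ : ∀ k l, Commute (J k) (J l)) (hGJ : ∀ k l, k ≠ l → Commute (G k) (J l))
    (hpair : ∀ k, G k * J k - J k * G k = 1) :
    ∃ u v : Fin p → E, IsWeylFamily u v ∧ (∀ j, Commute Z (u j)) ∧ (∀ j, Commute Z (v j)) ∧
      (∀ j l, Commute (ι l) (u j)) ∧ ∀ j l, Commute (ι l) (v j) := by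
  let T : (ZMod p → E) → L → E := fun H m => ∑ k, ι ((σ ^ k.val) m) * H k
  have hιι : ∀ l m, Commute (ι l) (ι m) := fun l m => (Commute.all l m).map ι
  have hTZ : ∀ H : ZMod p → E, (∀ k, Z * H k = H (k + 1) * Z) → ∀ m, (σ ^ p) m = m →
      Commute Z (T H m) := fun H hH m hm => by
    change Z * T H m = T H m * Z
    simp only [T, Finset.mul_sum, Finset.sum_mul]
    conv_rhs => rw [← Equiv.sum_comp (Equiv.addRight (1 : ZMod p))]
    refine Finset.sum_congr rfl fun k _ => ?_
    simp only [Equiv.coe_addRight]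
    rw [pow_val_add_one_apply hm, ← mul_assoc, hZ, mul_assoc, hH, mul_assoc]
  have hTι : ∀ H : ZMod p → E, (∀ l k, Commute (ι l) (H k)) → ∀ m l, Commute (ι l) (T H m) :=
    fun H hH m l => Commute.sum_right _ _ _ fun k _ => (hιι _ _).mul_right (hH _ _)
  have hTT : ∀ H H' : ZMod p → E, (∀ l k, Commute (ι l) (H k)) → (∀ l k, Commute (ι l) (H' k)) →
      (∀ k l, Commute (H k) (H' l)) → ∀ m n, Commute (T H m) (T H' n) :=
    fun H H' hH hH' hHH' m n => Commute.sum_left _ _ _ fun k _ => Commute.sum_right _ _ _ fun l _ =>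
      ((hιι _ _).mul_right (hH' _ _)).mul_left ((hH _ _).symm.mul_right (hHH' _ _))
  have hGJ' : ∀ k l, G k * J l = J l * G k + if k = l then 1 else 0 := fun k l => by
    split_ifs with hkl
    · subst hkl
      rw [← hpair k, add_sub_cancel]
    · rw [(hGJ k l hkl).eq, add_zero]
  have hbr : ∀ m n, T G m * T J n = T J n * T G m +
      ι (∑ k ∈ Finset.range p, (σ ^ k) (m * n)) := fun m n => by
    have h1 : ∀ k l : ZMod p, ι ((σ ^ k.val) m) * G k * (ι ((σ ^ l.val) n) * J l) =
        ι ((σ ^ l.val) n) * J l * (ι ((σ ^ k.val) m) * G k) +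
          if k = l then ι ((σ ^ k.val) (m * n)) else 0 := fun k l => by
      rw [mul_assoc, ← mul_assoc (G k), ← (hιG _ _).eq, mul_assoc, hGJ', mul_assoc (ι _) (J l),
        ← mul_assoc (J l), ← (hιJ _ _).eq, mul_assoc _ (J l) (G k), mul_add, mul_add,
        ← mul_assoc, (hιι _ _).eq, mul_assoc]
      congr 1
      split_ifs with hkl
      · subst hkl
        rw [mul_one, map_mul, map_mul]
      · rw [mul_zero, mul_zero]
    rw [← sum_zmod_val, map_sum]
    simp only [T, Finset.sum_mul, Finset.mul_sum]
    simp only [h1, Finset.sum_add_distrib]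
    rw [Finset.sum_comm]
    simp
  refine ⟨fun j => T G (e j), fun j => T J (f j), ⟨fun j => ?_, fun j m => ?_, fun j m => ?_,
    fun j m hjm => ?_⟩, fun j => hTZ G hZG _ (he j), fun j => hTZ J hZJ _ (hf j),
    fun j => hTι G hιG _, fun j => hTι J hιJ _⟩
  · rw [hbr, hef, if_pos rfl, map_one, add_sub_cancel_left]
  · exact hTT G G hιG hιG hGG _ _
  · exact hTT J J hιJ hιJ hJJ _ _
  · change _ = _
    rw [hbr, hef, if_neg hjm, map_zero, add_zero]

end TwistedWeyl

section TwistedModule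
variable {F L : Type} [Field F] [Field L] [Algebra F L]

lemma apply_pow_val_of_artinSchreier {p : ℕ} [NeZero p] {σ : L ≃ₐ[F] L} {θ : L}
    (hθ : (σ ^ p) θ = θ + 1) (k : ZMod p) :
    σ ((σ ^ k.val) θ) = (σ ^ (k + 1).val) θ + if k + 1 = 0 then 1 else 0 := by
  have hval : (k + 1).val = (k.val + 1) % p := by
    rw [ZMod.val_add, ZMod.val_one_eq_one_mod, Nat.add_mod_mod]
  rw [← AlgEquiv.mul_apply, ← pow_succ']
  simp only [← ZMod.val_eq_zero]
  rcases (Nat.succ_le_of_lt (ZMod.val_lt k)).lt_or_eq with h | h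
  · rw [hval, Nat.mod_eq_of_lt h, if_neg (Nat.succ_ne_zero _), add_zero]
  · have h' : k.val + 1 = p := h
    rw [hval, h', Nat.mod_self, if_pos rfl, hθ, pow_zero, AlgEquiv.one_apply]

lemma mul_pow_eq_prod_mul_pow {E : Type} [Monoid E] {p : ℕ} {J : ZMod p → E} {S : E}
    (hSJ : ∀ k, S * J k = J (k + 1) * S) (n : ℕ) :
    (J 0 * S) ^ n = ((List.range n).map fun k : ℕ => J (k : ZMod p)).prod * S ^ n := by
  have hS : ∀ n : ℕ, S ^ n * J 0 = J n * S ^ n := fun n => by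
    induction n with
    | zero => simp
    | succ n ih => rw [pow_succ', mul_assoc, ih, ← mul_assoc, hSJ, mul_assoc, Nat.cast_succ]
  induction n with
  | zero => simp
  | succ n ih =>
    rw [pow_succ, ih, List.prod_range_succ, mul_assoc, ← mul_assoc (S ^ n), hS, mul_assoc,
      mul_assoc, pow_succ]

lemma prod_range_mul_eq_pow {E : Type} [Monoid E] {p : ℕ} (J : ZMod p → E) (m : ℕ) :
    ((List.range (p * m)).map fun k : ℕ => J (k : ZMod p)).prod =
      ((List.range p).map fun k : ℕ => J (k : ZMod p)).prod ^ m := by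
  induction m with
  | zero => simp
  | succ m ih =>
    rw [mul_add_one, List.range_add, List.map_append, List.prod_append, ih, pow_succ,
      List.map_map]
    congr 3
    funext k
    simp

lemma prod_range_pow_eq_map {E R : Type} [Monoid E] [CommMonoid R] {p : ℕ} {J : ZMod p → E}
    {ξ : ZMod p → R} (ι : R →* E) (hJJ : ∀ k l, Commute (J k) (J l))
    (hJ : ∀ k, J k ^ p = ι (ξ k)) (n : ℕ) :
    ((List.range n).map fun k : ℕ => J (k : ZMod p)).prod ^ p = ι (∏ k ∈ Finset.range n, ξ k) := by
  induction n with
  | zero => simp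
  | succ n ih =>
    have hc : Commute ((List.range n).map fun k : ℕ => J (k : ZMod p)).prod (J n) :=
      Commute.list_prod_left _ _ fun y hy => by
        obtain ⟨k, -, rfl⟩ := List.mem_map.mp hy
        exact hJJ _ _
    rw [List.prod_range_succ, hc.mul_pow, ih, hJ, Finset.prod_range_succ, map_mul]

lemma Commute.of_mul_eq_one {E : Type} [Monoid E] {a y y' : E} (h : Commute a y)
    (hy : y * y' = 1) (hy' : y' * y = 1) : Commute a y' := by
  let Y : Eˣ := ⟨y, y', hy, hy'⟩
  exact Commute.units_inv_right (u := Y) h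

lemma exists_twisted_weyl_module (p : ℕ) [Fact p.Prime] [CharP L p] (σ : L ≃ₐ[F] L)
    (hσ : σ ^ (p * p) = 1) {x θ : L} {b : F} (hx : (σ ^ p) x = x) (hx0 : x ≠ 0)
    (hb : ∏ k ∈ Finset.range p, (σ ^ k) x = algebraMap F L b) (hθ : (σ ^ p) θ = θ + 1) :
    ∃ (G J : ZMod p → Module.End F ((ZMod p → ZMod p) → L))
      (Z : Module.End F ((ZMod p → ZMod p) → L)) (ι : L →ₐ[F] Module.End F _),
      (∀ l, Z * ι l = ι (σ l) * Z) ∧ (∀ k, Z * G k = G (k + 1) * Z) ∧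
      (∀ k, Z * J k = J (k + 1) * Z) ∧ (∀ l k, Commute (ι l) (G k)) ∧
      (∀ l k, Commute (ι l) (J k)) ∧ (∀ k l, Commute (G k) (G l)) ∧
      (∀ k l, Commute (J k) (J l)) ∧ (∀ k l, k ≠ l → Commute (G k) (J l)) ∧
      (∀ k, G k * J k - J k * G k = 1) ∧ Z ^ (p * p) = algebraMap F _ b := by
  let V := (ZMod p → ZMod p) → L
  let ξ : ZMod p → L := fun k => (σ ^ k.val) x
  let γ : ZMod p → ZMod p → L := fun k t => if t = 0 then ξ k else 1
  let η : ZMod p → L := fun k => (σ ^ k.val) θ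
  let ε : ZMod p → ZMod p → ZMod p := fun k => Pi.single k 1
  have hεs : ∀ k, ε k k = 1 := fun k => Pi.single_eq_same k 1
  have hεn : ∀ {k l}, l ≠ k → ε k l = 0 := fun h => Pi.single_eq_of_ne h 1
  have hεS : ∀ k l, ε (k + 1) (l + 1) = ε k l := fun k l => by
    by_cases h : l = k
    · rw [h, hεs, hεs]
    · rw [hεn h, hεn fun h' => h (add_right_cancel h')]
  have hξ : ∀ k, σ (ξ k) = ξ (k + 1) := fun k => (pow_val_add_one_apply hx k).symm
  have hη : ∀ k, σ (η k) = η (k + 1) + if k + 1 = 0 then 1 else 0 :=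
    apply_pow_val_of_artinSchreier hθ
  have hγ : ∀ k t, σ (γ k t) = γ (k + 1) t := fun k t => by
    simp only [γ]
    split_ifs
    · exact hξ k
    · exact map_one σ
  have hγ0 : ∀ k t, γ k t ≠ 0 := fun k t => by
    simp only [γ]
    split_ifs
    · exact (map_ne_zero_iff _ (σ ^ k.val).injective).mpr hx0
    · exact one_ne_zero
  let J : ZMod p → Module.End F V := fun k =>
    { toFun := fun f a => γ k (a k) * f (a - ε k)
      map_add' := fun f g => funext fun a => mul_add _ _ _
      map_smul' := fun r f => funext fun a => mul_smul_comm _ _ _ }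
  let J' : ZMod p → Module.End F V := fun k =>
    { toFun := fun f a => (γ k (a k + 1))⁻¹ * f (a + ε k)
      map_add' := fun f g => funext fun a => mul_add _ _ _
      map_smul' := fun r f => funext fun a => mul_smul_comm _ _ _ }
  let A : ZMod p → Module.End F V := fun k =>
    { toFun := fun f a => (η k + (a k).cast) * f a
      map_add' := fun f g => funext fun a => mul_add _ _ _
      map_smul' := fun r f => funext fun a => mul_smul_comm _ _ _ }
  let S : Module.End F V :=
    { toFun := fun f a => σ (f fun k => a (k + 1))
      map_add' := fun f g => funext fun a => map_add σ _ _
      map_smul' := fun r f => funext fun a => map_smul σ r _ }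
  let ι : L →ₐ[F] Module.End F V := Algebra.lsmul F F V
  have hJ : ∀ k f a, J k f a = γ k (a k) * f (a - ε k) := fun _ _ _ => rfl
  have hJ' : ∀ k f a, J' k f a = (γ k (a k + 1))⁻¹ * f (a + ε k) := fun _ _ _ => rfl
  have hA : ∀ k f a, A k f a = (η k + (a k).cast) * f a := fun _ _ _ => rfl
  have hS : ∀ f a, S f a = σ (f fun k => a (k + 1)) := fun _ _ => rfl
  have hι : ∀ l f a, ι l f a = l * f a := fun _ _ _ => rfl
  have hext : ∀ P Q : Module.End F V, (∀ f a, P f a = Q f a) → P = Q := fun P Q h =>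
    LinearMap.ext fun f => funext fun a => h f a
  have hJJ' : ∀ k, J k * J' k = 1 := fun k => hext _ _ fun f a => by
    rw [Module.End.mul_apply, hJ, hJ', Pi.sub_apply, hεs, sub_add_cancel, sub_add_cancel,
      mul_inv_cancel_left₀ (hγ0 _ _), Module.End.one_apply]
  have hJ'J : ∀ k, J' k * J k = 1 := fun k => hext _ _ fun f a => by
    rw [Module.End.mul_apply, hJ', hJ, Pi.add_apply, hεs, add_sub_cancel_right,
      inv_mul_cancel_left₀ (hγ0 _ _), Module.End.one_apply]
  have hιJ : ∀ l k, Commute (ι l) (J k) := fun l k => hext _ _ fun f a => by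
    simp only [Module.End.mul_apply, hι, hJ]
    ring
  have hιA : ∀ l k, Commute (ι l) (A k) := fun l k => hext _ _ fun f a => by
    simp only [Module.End.mul_apply, hι, hA]
    ring
  have hSι : ∀ l, S * ι l = ι (σ l) * S := fun l => hext _ _ fun f a => by
    simp only [Module.End.mul_apply, hι, hS, map_mul]
  have hJJ : ∀ k l, Commute (J k) (J l) := fun k l => hext _ _ fun f a => by
    by_cases h : k = l
    · rw [h]
    · simp only [Module.End.mul_apply, hJ, Pi.sub_apply, hεn h, hεn (Ne.symm h), sub_zero]
      rw [sub_right_comm]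
      ring
  have hAJ : ∀ k l, k ≠ l → Commute (A k) (J l) := fun k l h => hext _ _ fun f a => by
    simp only [Module.End.mul_apply, hJ, hA, Pi.sub_apply, hεn h, sub_zero]
    ring
  have hAA : ∀ k l, Commute (A k) (A l) := fun k l => hext _ _ fun f a => by
    simp only [Module.End.mul_apply, hA]
    ring
  have hAJk : ∀ k, A k * J k = J k * A k + J k := fun k => hext _ _ fun f a => by
    have hc : ((a k - 1 : ZMod p).cast : L) = (a k).cast - 1 := by
      rw [ZMod.cast_sub', ZMod.cast_one']
    change A k (J k f) a = J k (A k f) a + J k f a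
    simp only [hJ, hA, Pi.sub_apply, hεs, hc]
    ring
  have hSJ : ∀ k, S * J k = J (k + 1) * S := fun k => hext _ _ fun f a => by
    simp only [Module.End.mul_apply, hJ, hS, map_mul, hγ]
    congr 3
    funext l
    rw [Pi.sub_apply, Pi.sub_apply, hεS]
  have hZA : ∀ k, J 0 * S * A k = A (k + 1) * (J 0 * S) := fun k => hext _ _ fun f a => by
    have hσc : ∀ t : ZMod p, σ (t.cast : L) = t.cast := fun t => by
      rw [ZMod.cast_eq_val, map_natCast]
    have hc : σ (η k + ((a - ε 0) (k + 1)).cast) = η (k + 1) + (a (k + 1)).cast := by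
      rw [map_add, hη, Pi.sub_apply]
      by_cases h : k + 1 = 0
      · rw [if_pos h, h, hεs, ZMod.cast_sub', ZMod.cast_one', map_sub, map_one, hσc]
        ring
      · rw [if_neg h, hεn h, sub_zero, add_zero, hσc]
    simp only [Module.End.mul_apply, hJ, hS, hA, map_mul]
    rw [hc]
    ring
  have hJc : ∀ {P : Module.End F V} {k}, Commute P (J k) → Commute P (J' k) :=
    fun h => h.of_mul_eq_one (hJJ' _) (hJ'J _)
  have hZJ : ∀ k, J 0 * S * J k = J (k + 1) * (J 0 * S) := fun k => by
    rw [mul_assoc, hSJ, ← mul_assoc, (hJJ _ _).eq, mul_assoc]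
  have hZJ' : ∀ k, J 0 * S * J' k = J' (k + 1) * (J 0 * S) := fun k => by
    rw [← one_mul (J 0 * S * J' k), ← hJ'J (k + 1), mul_assoc, ← mul_assoc (J (k + 1)), ← hZJ,
      mul_assoc _ (J k), hJJ', mul_one]
  have hpow : ∀ k (n : ℕ) f a, (J k ^ n) f a =
      (∏ j ∈ Finset.range n, γ k (a k - j)) * f (a - n • ε k) := fun k n => by
    induction n with
    | zero => intro f a; simp
    | succ n ih =>
      intro f a
      rw [pow_succ, Module.End.mul_apply, ih, hJ, Finset.prod_range_succ, mul_assoc, succ_nsmul,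
        sub_add_eq_sub_sub, Pi.sub_apply, Pi.smul_apply, hεs, nsmul_one]
  have hJp : ∀ k, J k ^ p = ι (ξ k) := fun k => hext _ _ fun f a => by
    have hp0 : p • ε k = 0 := by
      funext l
      rw [Pi.smul_apply, nsmul_eq_mul, CharP.cast_eq_zero, zero_mul, Pi.zero_apply]
    rw [hpow, hp0, sub_zero, hι, Finset.prod_eq_single (a k).val]
    · rw [ZMod.natCast_zmod_val, sub_self]
      simp only [γ, if_true]
    · intro j hj hne
      refine if_neg fun h => hne ?_
      rw [sub_eq_zero.mp h, ZMod.val_natCast, Nat.mod_eq_of_lt (Finset.mem_range.mp hj)]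
    · exact fun h => (h (Finset.mem_range.mpr (ZMod.val_lt _))).elim
  have hSn : ∀ (n : ℕ) f a, (S ^ n) f a = (σ ^ n) (f fun k => a (k + n)) := fun n => by
    induction n with
    | zero => intro f a; simp
    | succ n ih =>
      intro f a
      rw [pow_succ, Module.End.mul_apply, ih, hS, pow_succ, AlgEquiv.mul_apply]
      congr 3
      funext k
      rw [Nat.cast_succ, add_assoc, add_comm (n : ZMod p)]
  have hSp : S ^ (p * p) = 1 := hext _ _ fun f a => by
    rw [hSn, hσ]
    simp
  have hξb : ∏ k ∈ Finset.range p, ξ (k : ZMod p) = algebraMap F L b := by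
    rw [← hb]
    refine Finset.prod_congr rfl fun k hk => ?_
    simp only [ξ]
    rw [ZMod.val_natCast, Nat.mod_eq_of_lt (Finset.mem_range.mp hk)]
  have hGJ : ∀ k l, k ≠ l → Commute (J' k * A k) (J l) := fun k l h =>
    (hJc (hJJ l k)).symm.mul_left (hAJ k l h)
  have hAJ' : ∀ k l, Commute (J' k * A k) (J' l * A l) := fun k l => by
    by_cases h : k = l
    · rw [h]
    · exact (hJc (hGJ k l h)).mul_right
        ((hJc (hAJ l k (Ne.symm h))).symm.mul_left (hAA k l))
  refine ⟨fun k => J' k * A k, J, J 0 * S, ι, fun l => ?_, fun k => ?_, hZJ,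
    fun l k => (hJc (hιJ l k)).mul_right (hιA l k), hιJ, hAJ', hJJ, hGJ, fun k => ?_, ?_⟩
  · rw [mul_assoc, hSι, ← mul_assoc, ← (hιJ _ _).eq, mul_assoc]
  · rw [← mul_assoc, hZJ', mul_assoc, hZA, mul_assoc]
  · rw [mul_assoc, hAJk, mul_add, ← mul_assoc, ← mul_assoc, hJ'J, hJJ', one_mul,
      add_sub_cancel_left]
  · rw [mul_pow_eq_prod_mul_pow hSJ, hSp, mul_one, prod_range_mul_eq_pow,
      prod_range_pow_eq_map (ι : L →* Module.End F V) hJJ hJp, hξb]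
    exact ι.commutes b

end TwistedModule

lemma nonempty_algEquiv_matrix_fin_one (F A : Type) [Field F] [Ring A] [Algebra F A] :
    Nonempty (A ≃ₐ[F] Matrix (Fin 1) (Fin 1) A) :=
  ⟨AlgEquiv.ofBijective (Matrix.scalarAlgHom (Fin 1) F)
    ⟨fun _ _ h => by simpa using congrFun (congrFun h 0) 0, fun M => ⟨M 0 0, by
      ext i j
      fin_cases i
      fin_cases j
      simp⟩⟩⟩

/-- A cyclic algebra of exponent `p` and degree `p ^ 2` over a field of
characteristic `p` has `p`-symbol length at most `p`. -/
theorem statement2 (p : ℕ) (hp : p.Prime) (F : Type) [Field F] [CharP F p]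
    (C : Type) [Ring C] [Algebra F C] (hC : IsCyclicAlgebra F C (p ^ 2))
    (hexp : HasExponent F C p) :
    SymbolLengthLE p F C p := by
  have : Fact p.Prime := ⟨hp⟩
  obtain ⟨⟨_, _, _⟩, hCrank, L, _, _, _, _, hL, ⟨i⟩⟩ := hC
  have : FiniteDimensional F L :=
    FiniteDimensional.of_finrank_pos (hL ▸ pow_pos hp.pos 2)
  have : CharP L p := charP_of_injective_algebraMap (algebraMap F L).injective p
  have hLp : Module.finrank F L = p * p := hL.trans (sq p)
  have hCL : Module.finrank F C = Module.finrank F L ^ 2 := by rw [hCrank, hL]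
  obtain ⟨σ, hσgen⟩ := IsCyclic.exists_generator (α := L ≃ₐ[F] L)
  have hσ : orderOf σ = Module.finrank F L := by
    rw [orderOf_eq_card_of_forall_mem_zpowers hσgen, IsGalois.card_aut_eq_finrank]
  have hσp : orderOf (σ ^ p) = p := by
    rw [orderOf_pow_of_dvd hp.ne_zero (hσ.trans hLp ▸ dvd_mul_right p p), hσ, hLp,
      Nat.mul_div_cancel _ hp.pos]
  have hσ1 : σ ^ (p * p) = 1 := hLp ▸ hσ ▸ pow_orderOf_eq_one σ
  obtain ⟨z, b, hzb⟩ := exists_isCyclicPresentation i σ hσ hCL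
  obtain ⟨l, hl⟩ := hzb.exists_norm_eq_of_isSplitAlg hσ hCL hp.pos hexp.2.1
  rw [hLp] at hl
  obtain ⟨x, hx, hxb⟩ := exists_prod_pow_apply_eq hp.pos σ hσp l b hzb.ne_zero hl
  have hx0 : x ≠ 0 := fun h => hzb.ne_zero <| by
    rw [h, Finset.prod_congr rfl fun k _ => map_zero (σ ^ k), Finset.prod_const,
      Finset.card_range, zero_pow hp.ne_zero] at hxb
    exact (map_eq_zero _).mp hxb.symm
  obtain ⟨i', z', hop⟩ := hzb.op hσ hCL
  obtain ⟨θ, hθ⟩ := exists_apply_eq_add_one p hp.pos (σ ^ p) hσp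
  obtain ⟨G, J, Z, ι, hZ, hZG, hZJ, hιG, hιJ, hGG, hJJ, hGJ, hpair, hZp⟩ :=
    exists_twisted_weyl_module p σ hσ1 (x := x⁻¹) (b := b⁻¹) (by rw [map_inv₀, hx])
      (inv_ne_zero hx0) (by simp only [map_inv₀, Finset.prod_inv_distrib, hxb]) hθ
  obtain ⟨e, f, he, hf, hef⟩ := exists_dual_families hp.pos σ hσ hLp
  obtain ⟨u, v, huv, hZu, hZv, hιu, hιv⟩ := exists_isWeylFamily_of_twisted σ he hf hef ι Z G J
    hZ hZG hZJ hιG hιJ hGG hJJ hGJ hpair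
  obtain ⟨Ψ, hΨ⟩ := hop.exists_algHom ι Z hZ (hLp ▸ hZp)
  have hcomm : ∀ T, Commute Z T → (∀ l, Commute (ι l) T) → ∀ c, Commute T (Ψ c) :=
    fun T hT hιT c => by
      refine Submodule.span_induction (p := fun y _ => Commute T y) ?_ (Commute.zero_right _)
        (fun _ _ _ _ h h' => h.add_right h') (fun r _ _ h => h.smul_right r) (hΨ c)
      rintro _ ⟨⟨m, k⟩, rfl⟩
      exact (hιT m).symm.mul_right (hT.symm.pow_right k)
  have hpp : p - 2 + 2 = p := Nat.sub_add_cancel hp.two_le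
  have hV : Module.finrank F ((ZMod p → ZMod p) → L) = p ^ (p - 2) * Module.finrank F C := by
    rw [Module.finrank_pi_fintype, Finset.sum_const, hL, hCrank, Finset.card_univ,
      Fintype.card_fun, ZMod.card, smul_eq_mul]
    calc p ^ p * p ^ 2 = p ^ (p - 2 + 2) * p ^ 2 := by rw [hpp]
      _ = p ^ (p - 2) * (p ^ 2) ^ 2 := by ring
  obtain ⟨u', v', huv'⟩ := huv.exists_matrix Ψ hV (fun j => hcomm _ (hZu j) (hιu j))
    (fun j => hcomm _ (hZv j) (hιv j))
  have hX : Module.finrank F (Matrix (Fin (p ^ (p - 2))) (Fin (p ^ (p - 2))) C) = (p ^ 2) ^ p := by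
    rw [Module.finrank_matrix, hCrank, Fintype.card_fin]
    calc p ^ (p - 2) * p ^ (p - 2) * (p ^ 2) ^ 2 = (p ^ 2) ^ (p - 2 + 2) := by ring
      _ = (p ^ 2) ^ p := by rw [hpp]
  have : Nonempty (Fin (p ^ (p - 2))) := ⟨⟨0, pow_pos hp.pos _⟩⟩
  have : Algebra.IsCentral F (Matrix (Fin (p ^ (p - 2))) (Fin (p ^ (p - 2))) C) := inferInstance
  obtain ⟨D, hD, ⟨Φ⟩⟩ := huv'.exists_decomposition p hX
  exact ⟨p, le_rfl, fun k => D k, fun k => inferInstance, fun k => inferInstance, hD,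
    p ^ (p - 2), 1, pow_pos hp.pos _, one_pos,
    (nonempty_algEquiv_matrix_fin_one F _).map Φ.symm.trans⟩
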